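/- arXiv:2401.04676 — 2 statements merged into one kernel-verified Lean document; each statement's English description precedes it below -/
import Mathlib

section
/- Rank-stability is preserved by matrix algebras: let F be a field, let P_1,…,P_r ∈ F⟨x_1,…,x_d⟩ be noncommutative polynomials whose system admits an exact solution in M_n(F) for some n ≥ 1 (i.e., the presented algebra has a finite-dimensional representation), and let m ≥ 1. Consider the presentation of the m×m matrix algebra over the presented algebra with generators x_1,…,x_d and e_{ij} (1 ≤ i,j ≤ m) and relations P_1,…,P_r, Σ_{i=1}^m e_{ii} − 1, e_{ij}e_{kℓ} − δ_{jk}e_{iℓ} (all i,j,k,ℓ), and e_{ij}x_k − x_ke_{ij} (all i,j,k). This presentation is rank-stable if and only if the presentation F⟨x_1,…,x_d⟩/⟨P_1,…,P_r⟩ is rank-stable. -/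
open Matrix

noncomputable section

/-- Zero-padding of a square matrix to size `m` (the ℕ×ℕ extension `Â`, clipped to size `m`). -/
def padTo {F : Type} [Zero F] {n : ℕ} (m : ℕ) (A : Matrix (Fin n) (Fin n) F) :
    Matrix (Fin m) (Fin m) F :=
  Matrix.of fun i j =>
    if h : (i : ℕ) < n ∧ (j : ℕ) < n then A ⟨i, h.1⟩ ⟨j, h.2⟩ else 0

/-- `Rank(Â − B̂)` for `A ∈ M_n(F)` and `B ∈ M_{n'}(F)`. -/
def padRankDiff {F : Type} [Field F] {n n' : ℕ} (A : Matrix (Fin n) (Fin n) F)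
    (B : Matrix (Fin n') (Fin n') F) : ℕ :=
  (padTo (max n n') A - padTo (max n n') B).rank

/-- Evaluation of a noncommutative polynomial `P ∈ F⟨x_s : s ∈ σ⟩` at a tuple of matrices,
where scalar terms are interpreted as scalar matrices. -/
def evalPoly {F : Type} [Field F] {σ : Type} {n : ℕ}
    (P : FreeAlgebra F σ) (A : σ → Matrix (Fin n) (Fin n) F) :
    Matrix (Fin n) (Fin n) F :=
  FreeAlgebra.lift F A P

/-- Rank-stability of the presentation `F⟨x_s : s ∈ σ⟩ / ⟨P_i : i ∈ ι⟩`. -/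
def RankStable (F : Type) [Field F] {σ ι : Type} (P : ι → FreeAlgebra F σ) : Prop :=
  ∀ ε : ℝ, 0 < ε → ∃ δ : ℝ, 0 < δ ∧
    ∀ n : ℕ, 0 < n → ∀ A : σ → Matrix (Fin n) (Fin n) F,
      (∀ i, ((evalPoly (P i) A).rank : ℝ) < δ * n) →
      ∃ n' : ℕ, 0 < n' ∧ ∃ B : σ → Matrix (Fin n') (Fin n') F,
        (∀ i, evalPoly (P i) B = 0) ∧
        ∀ j, ((padRankDiff (A j) (B j) : ℝ) < ε * n)

/-- The relations of the presentation of `M_m(A)`, where `A` is presented by the relations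
`P` on generators `x_1,…,x_d`: extra generators `e_{ij}` (`1 ≤ i,j ≤ m`), and relations
`P_1,…,P_r`, `Σ_i e_{ii} − 1`, `e_{ij}e_{kℓ} − δ_{jk}e_{iℓ}`, `e_{ij}x_k − x_ke_{ij}`. -/
def matrixAlgebraRels (F : Type) [Field F] {d r m : ℕ}
    (P : Fin r → FreeAlgebra F (Fin d)) :
    (Fin r ⊕ (Unit ⊕ (((Fin m × Fin m) × (Fin m × Fin m)) ⊕ ((Fin m × Fin m) × Fin d)))) →
      FreeAlgebra F (Fin d ⊕ (Fin m × Fin m)) :=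
  let x : Fin d → FreeAlgebra F (Fin d ⊕ (Fin m × Fin m)) :=
    fun k => FreeAlgebra.ι F (Sum.inl k)
  let e : Fin m → Fin m → FreeAlgebra F (Fin d ⊕ (Fin m × Fin m)) :=
    fun i j => FreeAlgebra.ι F (Sum.inr (i, j))
  Sum.elim (fun j => FreeAlgebra.lift F x (P j))
    (Sum.elim
      (fun _ => (∑ i : Fin m, e i i) - 1)
      (Sum.elim
        (fun q => e q.1.1 q.1.2 * e q.2.1 q.2.2 -
          (if q.1.2 = q.2.1 then e q.1.1 q.2.2 else 0))
        (fun q => e q.1.1 q.1.2 * x q.2 - x q.2 * e q.1.1 q.1.2)))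

section RankBounds

variable {F : Type} [Field F] {α β γ τ : Type} [Fintype β]

lemma Matrix.rank_add_le' (M N : Matrix α β F) : (M + N).rank ≤ M.rank + N.rank := by
  unfold Matrix.rank
  rw [Matrix.mulVecLin_add]
  refine le_trans (Submodule.finrank_mono ?_)
    (Submodule.finrank_add_le_finrank_add_finrank _ _)
  exact LinearMap.range_add_le _ _

lemma Matrix.rank_neg' (M : Matrix α β F) : (-M).rank = M.rank := by
  classical
  have h : ∀ M : Matrix α β F, (-M).rank ≤ M.rank := fun M => by
    have := Matrix.rank_mul_le_left M (-1 : Matrix β β F)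
    simpa using this
  exact le_antisymm (h M) (by simpa using h (-M))

lemma Matrix.rank_sub_le' (M N : Matrix α β F) : (M - N).rank ≤ M.rank + N.rank := by
  rw [sub_eq_add_neg, ← Matrix.rank_neg' N]
  exact Matrix.rank_add_le' _ _

lemma Matrix.rank_sum_le' {κ : Type} (s : Finset κ) (M : κ → Matrix α β F) :
    (∑ i ∈ s, M i).rank ≤ ∑ i ∈ s, (M i).rank := by
  classical
  induction s using Finset.induction_on with
  | empty => simp
  | insert a s ha ih =>
    rw [Finset.sum_insert ha, Finset.sum_insert ha]
    exact (Matrix.rank_add_le' _ _).trans (by omega)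

lemma Matrix.rank_sandwich_le [Fintype α] [Fintype τ] (L : Matrix γ α F) (M : Matrix α β F)
    (R : Matrix β τ F) :
    (L * M * R).rank ≤ M.rank :=
  (Matrix.rank_mul_le_left _ _).trans (Matrix.rank_mul_le_right _ _)

lemma Matrix.eq_zero_of_rank_eq_zero {M : Matrix α β F} (h : M.rank = 0) : M = 0 := by
  classical
  have h' : M.mulVecLin = 0 := by
    rw [← LinearMap.range_eq_bot]
    exact Submodule.finrank_eq_zero.mp h
  rw [← Matrix.toLin'_apply'] at h'
  simpa using h'

/-- Rank factorization, with one-sided inverses of the two factors. -/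
lemma Matrix.exists_rank_factorization [Fintype α] [DecidableEq α] [DecidableEq β]
    (M : Matrix α β F) :
    ∃ (k : ℕ) (R : Matrix α (Fin k) F) (L : Matrix (Fin k) β F)
      (G : Matrix (Fin k) α F) (H : Matrix β (Fin k) F),
      M = R * L ∧ G * R = 1 ∧ L * H = 1 := by
  let W := LinearMap.range M.mulVecLin
  let e : W ≃ₗ[F] (Fin M.rank → F) := (Module.finBasis F W).equivFun
  let R : (Fin M.rank → F) →ₗ[F] (α → F) := W.subtype ∘ₗ e.symm.toLinearMap
  let L : (β → F) →ₗ[F] (Fin M.rank → F) := e.toLinearMap ∘ₗ M.mulVecLin.rangeRestrict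
  have hR : LinearMap.ker R = ⊥ := by
    rw [LinearMap.ker_eq_bot]
    exact W.injective_subtype.comp e.symm.injective
  have hL : LinearMap.range L = ⊤ := by
    rw [LinearMap.range_eq_top]
    exact e.surjective.comp M.mulVecLin.surjective_rangeRestrict
  obtain ⟨G, hG⟩ := R.exists_leftInverse_of_injective hR
  obtain ⟨H, hH⟩ := L.exists_rightInverse_of_surjective hL
  refine ⟨M.rank, LinearMap.toMatrix' R, LinearMap.toMatrix' L, LinearMap.toMatrix' G,
    LinearMap.toMatrix' H, ?_, ?_, ?_⟩
  · rw [← LinearMap.toMatrix'_comp]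
    have : R ∘ₗ L = M.mulVecLin := by
      refine LinearMap.ext fun x => ?_
      simp [R, L]
    rw [this, ← Matrix.toLin'_apply', LinearMap.toMatrix'_toLin']
  · rw [← LinearMap.toMatrix'_comp, hG, LinearMap.toMatrix'_id]
  · rw [← LinearMap.toMatrix'_comp, hH, LinearMap.toMatrix'_id]

/-- A square matrix can be made invertible by a perturbation whose rank is its corank. -/
lemma Matrix.exists_isUnit_rank_sub_le [DecidableEq β] (X Y : Matrix β β F) :
    ∃ Φ : Matrix β β F, IsUnit Φ ∧ (Φ - X).rank ≤ (1 - X * Y).rank := by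
  obtain ⟨V, U, e, hV, hU, h⟩ := X.exists_rank_normal_form
  set N : Matrix β β F := (fromBlocks 1 0 0 0).submatrix e e with hN
  have hNN : N * (1 - N) = 0 := by
    rw [mul_sub, mul_one, hN, Matrix.submatrix_mul_equiv, Matrix.fromBlocks_multiply]
    simp
  obtain ⟨v, rfl⟩ := hV
  obtain ⟨u, rfl⟩ := hU
  refine ⟨↑(v⁻¹ * u⁻¹), Units.isUnit _, ?_⟩
  have hX : X = (↑v⁻¹ : Matrix β β F) * N * (↑u⁻¹ : Matrix β β F) := by
    rw [← h]; simp [mul_assoc]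
  have h1 : (↑(v⁻¹ * u⁻¹) : Matrix β β F) - X
      = (↑v⁻¹ : Matrix β β F) * (1 - N) * (↑u⁻¹ : Matrix β β F) := by
    conv_lhs => rw [hX]
    simp [mul_sub, sub_mul]
  have h2 := Matrix.rank_add_rank_le_card_of_mul_eq_zero hNN
  have h3 : X.rank ≤ N.rank := by
    conv_lhs => rw [hX]
    exact Matrix.rank_sandwich_le _ _ _
  have h4 := Matrix.rank_add_le' (X * Y) (1 - X * Y)
  rw [add_sub_cancel, Matrix.rank_one] at h4
  have h5 := Matrix.rank_mul_le_left X Y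
  rw [h1]
  have h6 := Matrix.rank_sandwich_le (↑v⁻¹ : Matrix β β F) (1 - N) (↑u⁻¹ : Matrix β β F)
  omega

end RankBounds

section Clip

variable {F : Type} [Field F]

/-- The coordinate map `F^b → F^a` that truncates or pads by zeros. -/
def clip (F : Type) [Field F] (a b : ℕ) : Matrix (Fin a) (Fin b) F :=
  Matrix.of fun i j => if (i : ℕ) = j then 1 else 0

@[simp] lemma clip_self (a : ℕ) : clip F a a = 1 := by
  ext i j
  simp [clip, Matrix.one_apply, Fin.ext_iff]

lemma clip_mul_apply {a b : ℕ} {β : Type} (M : Matrix (Fin b) β F) (i : Fin a) (j : β) :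
    (clip F a b * M) i j = if h : (i : ℕ) < b then M ⟨i, h⟩ j else 0 := by
  rw [Matrix.mul_apply]
  split_ifs with h
  · rw [Finset.sum_eq_single ⟨i, h⟩]
    · simp [clip]
    · intro k _ hk
      have : (i : ℕ) ≠ k := fun h' => hk (Fin.ext h'.symm)
      simp [clip, this]
    · simp
  · refine Finset.sum_eq_zero fun k _ => ?_
    have : (i : ℕ) ≠ k := fun h' => h (h' ▸ k.2)
    simp [clip, this]

lemma mul_clip_apply {a b : ℕ} {α : Type} (M : Matrix α (Fin b) F) (i : α) (j : Fin a) :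
    (M * clip F b a) i j = if h : (j : ℕ) < b then M i ⟨j, h⟩ else 0 := by
  rw [Matrix.mul_apply]
  split_ifs with h
  · rw [Finset.sum_eq_single ⟨j, h⟩]
    · simp [clip]
    · intro k _ hk
      have : (k : ℕ) ≠ j := fun h' => hk (Fin.ext h')
      simp [clip, this]
    · simp
  · refine Finset.sum_eq_zero fun k _ => ?_
    have : (k : ℕ) ≠ j := fun h' => h (h' ▸ k.2)
    simp [clip, this]

lemma clip_mul_clip {a b c : ℕ} (h : a ≤ b ∨ c ≤ b) :
    clip F a b * clip F b c = clip F a c := by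
  ext i j
  rw [clip_mul_apply]
  have := i.2
  have := j.2
  split_ifs with h'
  · simp [clip]
  · have : (i : ℕ) ≠ j := by omega
    simp [clip, this]

lemma padTo_eq_clip {n : ℕ} (N : ℕ) (A : Matrix (Fin n) (Fin n) F) :
    padTo N A = clip F N n * A * clip F n N := by
  ext i j
  rw [mul_clip_apply]
  simp only [clip_mul_apply, padTo, Matrix.of_apply]
  split_ifs <;> first | rfl | (exfalso; tauto)

lemma rank_one_sub_clip_le (n k : ℕ) :
    (1 - clip F n k * clip F k n).rank ≤ n - k := by
  rcases le_total n k with h | h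
  · simp [clip_mul_clip (Or.inl h)]
  · have h0 : clip F k n * (1 - clip F n k * clip F k n) = 0 := by
      rw [Matrix.mul_sub, Matrix.mul_one, ← Matrix.mul_assoc, clip_mul_clip (Or.inl h),
        clip_self, Matrix.one_mul, sub_self]
    have h1 := Matrix.rank_add_rank_le_card_of_mul_eq_zero h0
    have h2 := Matrix.rank_mul_le_left (clip F k n) (clip F n k)
    rw [clip_mul_clip (Or.inl h), clip_self, Matrix.rank_one] at h2
    simp only [Fintype.card_fin] at h1 h2
    omega

lemma clip_mul_padTo_sub_mul_clip {n k N : ℕ} (hn : n ≤ N) (hk : k ≤ N)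
    (A : Matrix (Fin n) (Fin n) F) (B : Matrix (Fin k) (Fin k) F) :
    clip F k N * (padTo N A - padTo N B) * clip F N n
      = clip F k n * A - B * clip F k n := by
  rw [padTo_eq_clip, padTo_eq_clip, Matrix.mul_sub, Matrix.sub_mul]
  simp only [Matrix.mul_assoc]
  rw [clip_mul_clip (a := n) (b := N) (Or.inl hn),
    clip_mul_clip (a := k) (c := n) (b := N) (Or.inl hk), ← Matrix.mul_assoc,
    ← Matrix.mul_assoc (clip F k _), clip_mul_clip (Or.inl hk), clip_mul_clip (Or.inl hk)]
  simp

lemma rank_clip_mul_sub_le_padRankDiff {n k : ℕ} (A : Matrix (Fin n) (Fin n) F)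
    (B : Matrix (Fin k) (Fin k) F) :
    (clip F k n * A - B * clip F k n).rank ≤ padRankDiff A B := by
  rw [← clip_mul_padTo_sub_mul_clip (le_max_left n k) (le_max_right n k)]
  exact Matrix.rank_sandwich_le _ _ _

lemma padRankDiff_le {n k : ℕ} (A : Matrix (Fin n) (Fin n) F) (B : Matrix (Fin k) (Fin k) F) :
    padRankDiff A B ≤ (clip F k n * A - B * clip F k n).rank + (n - k) + (k - n) := by
  unfold padRankDiff
  set N := max n k with hN
  have hn : n ≤ N := le_max_left _ _
  have hk : k ≤ N := le_max_right _ _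
  set M := padTo N A - padTo N B with hM
  have h : clip F k N * M * clip F N n = clip F k n * A - B * clip F k n :=
    clip_mul_padTo_sub_mul_clip hn hk A B
  set Qk := clip F N k * clip F k N with hQk
  set Qn := clip F N n * clip F n N with hQn
  have hdec : M = clip F N k * (clip F k N * M * clip F N n) * clip F n N
      + (1 - Qk) * M + Qk * M * (1 - Qn) := by
    have : clip F N k * (clip F k N * M * clip F N n) * clip F n N = Qk * M * Qn := by
      simp only [hQk, hQn, Matrix.mul_assoc]
    rw [this]
    noncomm_ring
  have h1 := Matrix.rank_sandwich_le (clip F N k) (clip F k N * M * clip F N n) (clip F n N)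
  have h2 := (Matrix.rank_mul_le_left (1 - Qk) M).trans (rank_one_sub_clip_le N k)
  have h3 := (Matrix.rank_mul_le_right (Qk * M) (1 - Qn)).trans (rank_one_sub_clip_le N n)
  have h4 := Matrix.rank_add_le' (clip F N k * (clip F k N * M * clip F N n) * clip F n N
      + (1 - Qk) * M) (Qk * M * (1 - Qn))
  have h5 := Matrix.rank_add_le' (clip F N k * (clip F k N * M * clip F N n) * clip F n N)
      ((1 - Qk) * M)
  rw [← hdec] at h4
  rw [← h]
  omega

end Clip

section Evaluation

variable {F : Type} [Field F] {σ : Type}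

lemma evalPoly_ι {n : ℕ} (A : σ → Matrix (Fin n) (Fin n) F) (j : σ) :
    evalPoly (FreeAlgebra.ι F j) A = A j := by
  simp [evalPoly]

lemma evalPoly_mul {n : ℕ} (A : σ → Matrix (Fin n) (Fin n) F) (p q : FreeAlgebra F σ) :
    evalPoly (p * q) A = evalPoly p A * evalPoly q A := by
  simp [evalPoly]

lemma evalPoly_add {n : ℕ} (A : σ → Matrix (Fin n) (Fin n) F) (p q : FreeAlgebra F σ) :
    evalPoly (p + q) A = evalPoly p A + evalPoly q A := by
  simp [evalPoly]

lemma evalPoly_algebraMap {n : ℕ} (A : σ → Matrix (Fin n) (Fin n) F) (c : F) :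
    evalPoly (algebraMap F _ c) A = c • 1 := by
  simp [evalPoly, Algebra.algebraMap_eq_smul_one]

lemma evalPoly_zero_eq {n : ℕ} (p : FreeAlgebra F σ) :
    evalPoly p (fun _ => (0 : Matrix (Fin n) (Fin n) F))
      = FreeAlgebra.algebraMapInv p • 1 := by
  induction p with
  | grade0 c => simp [evalPoly_algebraMap, FreeAlgebra.algebraMapInv]
  | grade1 j => simp [evalPoly_ι, FreeAlgebra.algebraMapInv]
  | mul p q hp hq => simp [evalPoly_mul, hp, hq, smul_smul, mul_comm]
  | add p q hp hq => simp [evalPoly_add, hp, hq, add_smul]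

/-- Approximate intertwiners of tuples approximately intertwine polynomial evaluations. -/
lemma exists_rank_intertwine_le (p : FreeAlgebra F σ) :
    ∃ c : ℕ, ∀ (n k : ℕ) (A : σ → Matrix (Fin n) (Fin n) F) (T : σ → Matrix (Fin k) (Fin k) F)
      (S : Matrix (Fin k) (Fin n) F) (ρ : ℝ),
      (∀ j, ((S * A j - T j * S).rank : ℝ) ≤ ρ) →
        ((S * evalPoly p A - evalPoly p T * S).rank : ℝ) ≤ c * ρ := by
  induction p with
  | grade0 c => exact ⟨0, fun n k A T S ρ _ => by simp [evalPoly_algebraMap]⟩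
  | grade1 j => exact ⟨1, fun n k A T S ρ h => by simpa [evalPoly_ι] using h j⟩
  | mul p q hp hq =>
    obtain ⟨c, hc⟩ := hp
    obtain ⟨d, hd⟩ := hq
    refine ⟨c + d, fun n k A T S ρ h => ?_⟩
    have e : S * evalPoly (p * q) A - evalPoly (p * q) T * S
        = (S * evalPoly p A - evalPoly p T * S) * evalPoly q A
          + evalPoly p T * (S * evalPoly q A - evalPoly q T * S) := by
      simp only [evalPoly_mul, Matrix.mul_sub, Matrix.sub_mul, Matrix.mul_assoc]
      abel
    have h1 := hc n k A T S ρ h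
    have h2 := hd n k A T S ρ h
    have h3 := Matrix.rank_add_le' ((S * evalPoly p A - evalPoly p T * S) * evalPoly q A)
      (evalPoly p T * (S * evalPoly q A - evalPoly q T * S))
    have h4 := Matrix.rank_mul_le_left (S * evalPoly p A - evalPoly p T * S) (evalPoly q A)
    have h5 := Matrix.rank_mul_le_right (evalPoly p T) (S * evalPoly q A - evalPoly q T * S)
    rw [← e] at h3
    have h6 : ((S * evalPoly (p * q) A - evalPoly (p * q) T * S).rank : ℝ)
        ≤ (S * evalPoly p A - evalPoly p T * S).rank
          + (S * evalPoly q A - evalPoly q T * S).rank := by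
      exact_mod_cast h3.trans (add_le_add h4 h5)
    push_cast
    linarith
  | add p q hp hq =>
    obtain ⟨c, hc⟩ := hp
    obtain ⟨d, hd⟩ := hq
    refine ⟨c + d, fun n k A T S ρ h => ?_⟩
    have e : S * evalPoly (p + q) A - evalPoly (p + q) T * S
        = (S * evalPoly p A - evalPoly p T * S)
          + (S * evalPoly q A - evalPoly q T * S) := by
      simp only [evalPoly_add, Matrix.mul_add, Matrix.add_mul]
      abel
    have h1 := hc n k A T S ρ h
    have h2 := hd n k A T S ρ h
    have h3 := Matrix.rank_add_le' (S * evalPoly p A - evalPoly p T * S)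
      (S * evalPoly q A - evalPoly q T * S)
    rw [← e] at h3
    have h6 : ((S * evalPoly (p + q) A - evalPoly (p + q) T * S).rank : ℝ)
        ≤ (S * evalPoly p A - evalPoly p T * S).rank
          + (S * evalPoly q A - evalPoly q T * S).rank := by
      exact_mod_cast h3
    push_cast
    linarith

lemma mul_evalPoly_eq {n k : ℕ} {A : σ → Matrix (Fin n) (Fin n) F}
    {T : σ → Matrix (Fin k) (Fin k) F} {S : Matrix (Fin k) (Fin n) F}
    (h : ∀ j, S * A j = T j * S) (p : FreeAlgebra F σ) :
    S * evalPoly p A = evalPoly p T * S := by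
  obtain ⟨c, hc⟩ := exists_rank_intertwine_le p
  have h1 := hc n k A T S 0 fun j => by simp [h j]
  rw [mul_zero] at h1
  exact sub_eq_zero.mp (Matrix.eq_zero_of_rank_eq_zero (by exact_mod_cast h1.antisymm (by positivity)))

end Evaluation

/-- A coordinate-free form of rank-stability: the exact solution is compared with the given tuple
through an approximately invertible approximate intertwiner. -/
def IntertwinerStable (F : Type) [Field F] {σ ι : Type} (P : ι → FreeAlgebra F σ) : Prop :=
  ∀ ε : ℝ, 0 < ε → ∃ δ : ℝ, 0 < δ ∧
    ∀ n : ℕ, 0 < n → ∀ A : σ → Matrix (Fin n) (Fin n) F,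
      (∀ i, ((evalPoly (P i) A).rank : ℝ) < δ * n) →
      ∃ (k : ℕ) (T : σ → Matrix (Fin k) (Fin k) F) (S : Matrix (Fin k) (Fin n) F)
        (S' : Matrix (Fin n) (Fin k) F),
        (∀ i, evalPoly (P i) T = 0) ∧
        (∀ j, ((S * A j - T j * S).rank : ℝ) < ε * n) ∧
        ((1 - S' * S).rank : ℝ) < ε * n ∧ ((1 - S * S').rank : ℝ) < ε * n

section ToRankStable

variable {F : Type} [Field F]

lemma le_add_rank_one_sub_mul {n k : ℕ} (S : Matrix (Fin k) (Fin n) F)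
    (S' : Matrix (Fin n) (Fin k) F) : n ≤ k + (1 - S' * S).rank := by
  have h1 := Matrix.rank_add_le' (S' * S) (1 - S' * S)
  have h2 := Matrix.rank_mul_le_left S' S
  have h3 := S'.rank_le_width
  rw [add_sub_cancel, Matrix.rank_one, Fintype.card_fin] at h1
  omega

lemma exists_conj_padRankDiff_le {n k : ℕ} (S : Matrix (Fin k) (Fin n) F)
    (S' : Matrix (Fin n) (Fin k) F) :
    ∃ Φ Ψ : Matrix (Fin k) (Fin k) F, Φ * Ψ = 1 ∧ Ψ * Φ = 1 ∧ ∀ (A : Matrix (Fin n) (Fin n) F)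
      (T : Matrix (Fin k) (Fin k) F),
      padRankDiff A (Ψ * T * Φ)
        ≤ (S * A - T * S).rank + 5 * (1 - S' * S).rank + 3 * (1 - S * S').rank := by
  have hn := le_add_rank_one_sub_mul S S'
  have hk := le_add_rank_one_sub_mul S' S
  set X := S * clip F n k with hX
  obtain ⟨_, ⟨u, rfl⟩, hΦ⟩ := Matrix.exists_isUnit_rank_sub_le X (clip F k n * S')
  have hQ := rank_one_sub_clip_le (F := F) n k
  set Q := 1 - clip F n k * clip F k n with hQdef
  have hXY : 1 - X * (clip F k n * S') = (1 - S * S') + S * Q * S' := by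
    simp only [hX, hQdef, Matrix.mul_sub, Matrix.sub_mul, Matrix.mul_assoc, Matrix.mul_one]
    abel
  have h1 := Matrix.rank_add_le' (1 - S * S') (S * Q * S')
  have h2 := Matrix.rank_sandwich_le S Q S'
  rw [← hXY] at h1
  set Φ : Matrix (Fin k) (Fin k) F := ↑u with hΦu
  set Ψ : Matrix (Fin k) (Fin k) F := ↑u⁻¹ with hΨu
  have hΦΨ : Φ * Ψ = 1 := u.mul_inv
  have hΨΦ : Ψ * Φ = 1 := u.inv_mul
  refine ⟨Φ, Ψ, hΦΨ, hΨΦ, fun A T => ?_⟩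
  refine (padRankDiff_le _ _).trans ?_
  set D := Φ - X with hD
  have key : Φ * (clip F k n * A
        - (Ψ * T * Φ) * clip F k n)
      = (D * (clip F k n * A) - T * D * clip F k n)
        + ((S * A - T * S) + ((T * S) * Q - S * Q * A)) := by
    simp only [hD, hX, hQdef, Matrix.mul_sub, Matrix.sub_mul, ← Matrix.mul_assoc, Matrix.mul_one,
      hΦΨ, Matrix.one_mul]
    abel
  have key' : clip F k n * A - (Ψ * T * Φ) * clip F k n
      = Ψ * ((D * (clip F k n * A) - T * D * clip F k n)
        + ((S * A - T * S) + ((T * S) * Q - S * Q * A))) := by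
    rw [← key, ← Matrix.mul_assoc, hΨΦ, Matrix.one_mul]
  have r0 := Matrix.rank_mul_le_right Ψ
    ((D * (clip F k n * A) - T * D * clip F k n) + ((S * A - T * S) + ((T * S) * Q - S * Q * A)))
  rw [← key'] at r0
  have r1 := Matrix.rank_add_le' (D * (clip F k n * A) - T * D * clip F k n)
    ((S * A - T * S) + ((T * S) * Q - S * Q * A))
  have r2 := Matrix.rank_sub_le' (D * (clip F k n * A)) (T * D * clip F k n)
  have r3 := Matrix.rank_add_le' (S * A - T * S) ((T * S) * Q - S * Q * A)
  have r4 := Matrix.rank_sub_le' ((T * S) * Q) (S * Q * A)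
  have r5 := Matrix.rank_mul_le_left D (clip F k n * A)
  have r6 := Matrix.rank_sandwich_le T D (clip F k n)
  have r7 := Matrix.rank_mul_le_right (T * S) Q
  have r8 := Matrix.rank_sandwich_le S Q A
  omega

lemma IntertwinerStable.rankStable {σ ι : Type} {P : ι → FreeAlgebra F σ}
    (h : IntertwinerStable F P) : RankStable F P := by
  intro ε hε
  obtain ⟨δ, hδ, H⟩ := h (min ε 1 / 9) (by positivity)
  refine ⟨δ, hδ, fun n hn A hA => ?_⟩
  obtain ⟨k, T, S, S', hT, hS, hS1, hS2⟩ := H n hn A hA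
  have hn' : (0 : ℝ) < n := by exact_mod_cast hn
  have b1 : min ε 1 * n ≤ ε * n := by gcongr; exact min_le_left _ _
  have b2 : min ε 1 * n ≤ 1 * n := by gcongr; exact min_le_right _ _
  obtain ⟨Φ, Ψ, hΦΨ, hΨΦ, hΦ⟩ := exists_conj_padRankDiff_le S S'
  refine ⟨k, ?_, fun j => Ψ * T j * Φ, fun i => ?_, fun j => ?_⟩
  · by_contra hk
    have h1 := le_add_rank_one_sub_mul S S'
    have h2 : n ≤ (1 - S' * S).rank := by omega
    have h3 : (n : ℝ) ≤ (1 - S' * S).rank := by exact_mod_cast h2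
    linarith
  · have h1 := mul_evalPoly_eq (S := Φ) (T := T)
      (A := fun j => Ψ * T j * Φ)
      (fun j => by rw [← mul_assoc, ← mul_assoc, hΦΨ, one_mul]) (P i)
    rw [hT, zero_mul] at h1
    rw [← one_mul (evalPoly _ _), ← hΨΦ, mul_assoc, h1, mul_zero]
  · have h1 : (padRankDiff (A j) (Ψ * T j * Φ) : ℝ)
        ≤ (S * A j - T j * S).rank + 5 * (1 - S' * S).rank + 3 * (1 - S * S').rank := by
      exact_mod_cast hΦ (A j) (T j)
    have := hS j
    linarith

end ToRankStable

section OfRankStable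

variable {F : Type} [Field F] {σ : Type}

lemma padTo_mul_clip {n N : ℕ} (h : n ≤ N) (A : Matrix (Fin n) (Fin n) F) :
    padTo N A * clip F N n = clip F N n * A := by
  rw [padTo_eq_clip, Matrix.mul_assoc, clip_mul_clip (Or.inl h), clip_self, Matrix.mul_one]

lemma clip_mul_clip_mul_padTo {n N : ℕ} (h : n ≤ N) (A : Matrix (Fin n) (Fin n) F) :
    clip F N n * clip F n N * padTo N A = padTo N A := by
  rw [padTo_eq_clip]
  simp only [Matrix.mul_assoc]
  rw [← Matrix.mul_assoc (clip F n N), clip_mul_clip (Or.inl h), clip_self, Matrix.one_mul]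

lemma evalPoly_padTo {n N : ℕ} (h : n ≤ N) (A : σ → Matrix (Fin n) (Fin n) F)
    (p : FreeAlgebra F σ) :
    evalPoly p (fun j => padTo N (A j)) = clip F N n * evalPoly p A * clip F n N
      + FreeAlgebra.algebraMapInv p • (1 - clip F N n * clip F n N) := by
  set Q := clip F N n * clip F n N with hQ
  have h1 : clip F N n * evalPoly p A = evalPoly p (fun j => padTo N (A j)) * clip F N n :=
    mul_evalPoly_eq (fun j => (padTo_mul_clip h (A j)).symm) p
  have h2 : (1 - Q) * evalPoly p (fun _ => 0)
      = evalPoly p (fun j => padTo N (A j)) * (1 - Q) := by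
    refine mul_evalPoly_eq (fun j => ?_) p
    rw [mul_zero, mul_sub, mul_one, hQ, ← Matrix.mul_assoc, padTo_mul_clip h, ← padTo_eq_clip,
      sub_self]
  rw [evalPoly_zero_eq, mul_smul_comm, mul_one] at h2
  rw [h1, h2, Matrix.mul_assoc, ← hQ]
  noncomm_ring

/-- A matrix with a left inverse whose range is the sum of the ranges of a given family. -/
lemma exists_range_eq_sum {κ : Type} [Fintype κ] [DecidableEq κ] {N : ℕ}
    (D : κ → Matrix (Fin N) (Fin N) F) :
    ∃ (k : ℕ) (R : Matrix (Fin N) (Fin k) F) (G : Matrix (Fin k) (Fin N) F)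
      (X : κ → Matrix (Fin N) (Fin k) F),
      G * R = 1 ∧ (∀ j, R * G * D j = D j) ∧ R = ∑ j, D j * X j := by
  let M : Matrix (Fin N) (κ × Fin N) F := Matrix.of fun a p => D p.1 a p.2
  obtain ⟨k, R, L, G, H, hM, hG, hH⟩ := M.exists_rank_factorization
  refine ⟨k, R, G, fun j => Matrix.of fun b c => H (j, b) c, hG, fun j => ?_, ?_⟩
  · have h1 : R * G * M = M := by
      conv_lhs => rw [hM]
      rw [Matrix.mul_assoc, ← Matrix.mul_assoc G, hG, Matrix.one_mul, ← hM]
    ext a b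
    exact congrFun (congrFun h1 a) (j, b)
  · have h1 : R = M * H := by
      conv_rhs => rw [hM]
      rw [Matrix.mul_assoc, hH, Matrix.mul_one]
    conv_lhs => rw [h1]
    ext a c
    simp [Matrix.mul_apply, Matrix.sum_apply, Fintype.sum_prod_type, M]

lemma exists_intertwiner_of_constantCoeff_eq_zero [Fintype σ] {ι : Type}
    {P : ι → FreeAlgebra F σ} (hP : ∀ i, FreeAlgebra.algebraMapInv (P i) = 0) {n k : ℕ}
    (A : σ → Matrix (Fin n) (Fin n) F) (B : σ → Matrix (Fin k) (Fin k) F)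
    (hB : ∀ i, evalPoly (P i) B = 0) :
    ∃ (l : ℕ) (T : σ → Matrix (Fin l) (Fin l) F) (S : Matrix (Fin l) (Fin n) F)
      (S' : Matrix (Fin n) (Fin l) F),
      (∀ i, evalPoly (P i) T = 0) ∧
      (∀ j, (S * A j - T j * S).rank ≤ padRankDiff (A j) (B j)) ∧
      S' * S = 1 ∧ (1 - S * S').rank ≤ ∑ j, padRankDiff (A j) (B j) := by
  classical
  let N := max n k
  have hn : n ≤ N := le_max_left _ _
  have hk : k ≤ N := le_max_right _ _
  let Q : Matrix (Fin N) (Fin N) F := clip F N n * clip F n N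
  let D : σ → Matrix (Fin N) (Fin N) F := fun j => padTo N (A j) - padTo N (B j)
  obtain ⟨l, R, G, X, hGR, hRG, hR⟩ := exists_range_eq_sum
    (fun o : Option σ => o.elim Q D)
  have hRGQ : R * G * Q = Q := hRG none
  have hRGD : ∀ j, R * G * D j = D j := fun j => hRG (some j)
  have hRGB : ∀ j, R * G * padTo N (B j) = padTo N (B j) := fun j => by
    have e : padTo N (B j) = Q * padTo N (A j) - D j := by
      simp only [Q, D, clip_mul_clip_mul_padTo hn, sub_sub_cancel]
    rw [e, Matrix.mul_sub, ← Matrix.mul_assoc, hRGQ, hRGD]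
  have hQclip : Q * clip F N n = clip F N n := by
    simp only [Q]
    rw [Matrix.mul_assoc, clip_mul_clip (Or.inl hn), clip_self, Matrix.mul_one]
  have hclip : R * G * clip F N n = clip F N n := by
    rw [← hQclip, ← Matrix.mul_assoc, hRGQ]
  refine ⟨l, fun j => G * padTo N (B j) * R, G * clip F N n, clip F n N * R,
    fun i => ?_, fun j => ?_, ?_, ?_⟩
  · have h1 := mul_evalPoly_eq (S := R) (A := fun j => G * padTo N (B j) * R)
      (T := fun j => padTo N (B j)) (fun j => by
        rw [← Matrix.mul_assoc, ← Matrix.mul_assoc, hRGB]) (P i)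
    rw [evalPoly_padTo hk, hB, hP] at h1
    simp only [Matrix.mul_zero, Matrix.zero_mul, zero_smul, add_zero] at h1
    rw [← Matrix.one_mul (evalPoly _ _), ← hGR, Matrix.mul_assoc, h1, Matrix.mul_zero]
  · have e : G * clip F N n * A j - G * padTo N (B j) * R * (G * clip F N n)
        = G * D j * clip F N n := by
      have e1 : G * padTo N (B j) * R * (G * clip F N n) = G * (padTo N (B j) * clip F N n) := by
        simp only [Matrix.mul_assoc]
        rw [← Matrix.mul_assoc R, hclip]
      rw [e1, Matrix.mul_assoc, ← padTo_mul_clip hn, ← Matrix.mul_sub, ← Matrix.sub_mul,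
        ← Matrix.mul_assoc]
    rw [e]
    exact Matrix.rank_sandwich_le _ _ _
  · rw [Matrix.mul_assoc, ← Matrix.mul_assoc R, hclip, clip_mul_clip (Or.inl hn), clip_self]
  · have hQQ : (1 - Q) * Q = 0 := by
      have : Q * Q = Q := by
        conv_lhs => simp only [Q]
        rw [← Matrix.mul_assoc]
        change Q * clip F N n * clip F n N = Q
        rw [hQclip]
      rw [sub_mul, one_mul, this, sub_self]
    have e : 1 - G * clip F N n * (clip F n N * R)
        = ∑ j, (G * (1 - Q)) * D j * X (some j) := by
      have e1 : 1 - G * clip F N n * (clip F n N * R) = G * (1 - Q) * R := by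
        simp only [Q, Matrix.mul_sub, Matrix.sub_mul, Matrix.mul_one, hGR, Matrix.mul_assoc]
      rw [e1]
      conv_lhs => rw [hR]
      rw [Matrix.mul_sum, Fintype.sum_option]
      simp only [Option.elim]
      rw [Matrix.mul_assoc, ← Matrix.mul_assoc (1 - Q), hQQ]
      simp only [Matrix.zero_mul, Matrix.mul_zero, zero_add, Matrix.mul_assoc]
    rw [e]
    exact (Matrix.rank_sum_le' _ _).trans
      (Finset.sum_le_sum fun j _ => Matrix.rank_sandwich_le _ _ _)

lemma exists_rank_one_sub_clip_le {p : FreeAlgebra F σ}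
    (hp : FreeAlgebra.algebraMapInv p ≠ 0) :
    ∃ c : ℕ, ∀ (n k : ℕ) (A : σ → Matrix (Fin n) (Fin n) F) (B : σ → Matrix (Fin k) (Fin k) F)
      (ρ : ℝ), evalPoly p B = 0 → (∀ j, (padRankDiff (A j) (B j) : ℝ) ≤ ρ) →
      ((1 - clip F n k * clip F k n).rank : ℝ) ≤ c * ρ + (evalPoly p A).rank ∧
      ((1 - clip F k n * clip F n k).rank : ℝ) ≤ c * ρ + (evalPoly p A).rank := by
  obtain ⟨c, hc⟩ := exists_rank_intertwine_le p
  refine ⟨c, fun n k A B ρ hB hρ => ?_⟩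
  obtain ⟨N, hN⟩ : ∃ N, N = max n k := ⟨_, rfl⟩
  have hn : n ≤ N := hN ▸ le_max_left _ _
  have hk : k ≤ N := hN ▸ le_max_right _ _
  have hρ' : ∀ j, ((padTo N (A j) - padTo N (B j)).rank : ℝ) ≤ ρ := by
    subst hN
    exact hρ
  set a := FreeAlgebra.algebraMapInv p
  set Qn : Matrix (Fin N) (Fin N) F := clip F N n * clip F n N with hQn
  set Qk : Matrix (Fin N) (Fin N) F := clip F N k * clip F k N with hQk
  have h1 := hc N N (fun j => padTo N (A j)) (fun j => padTo N (B j)) 1 ρ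
    (fun j => by simpa using hρ' j)
  rw [one_mul, mul_one] at h1
  have e : Qn - Qk = (a⁻¹ • (1 : Matrix (Fin N) (Fin N) F)) *
      (clip F N n * evalPoly p A * clip F n N
        - (evalPoly p (fun j => padTo N (A j)) - evalPoly p (fun j => padTo N (B j)))) := by
    rw [evalPoly_padTo hn, evalPoly_padTo hk, hB, ← hQn, ← hQk, smul_mul_assoc, one_mul,
      eq_inv_smul_iff₀ hp]
    simp only [Matrix.mul_zero, Matrix.zero_mul, smul_sub]
    abel
  have h2 : (Qn - Qk).rank ≤ (evalPoly p A).rank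
      + (evalPoly p (fun j => padTo N (A j)) - evalPoly p (fun j => padTo N (B j))).rank := by
    rw [e]
    refine (Matrix.rank_mul_le_right _ _).trans ((Matrix.rank_sub_le' _ _).trans ?_)
    gcongr
    exact Matrix.rank_sandwich_le _ _ _
  have h3 : ((Qn - Qk).rank : ℝ) ≤ c * ρ + (evalPoly p A).rank := by
    have : ((Qn - Qk).rank : ℝ) ≤ (evalPoly p A).rank
      + (evalPoly p (fun j => padTo N (A j)) - evalPoly p (fun j => padTo N (B j))).rank := by
      exact_mod_cast h2
    linarith
  have en : 1 - clip F n k * clip F k n = clip F n N * (Qn - Qk) * clip F N n := by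
    have e1 : clip F n N * Qn * clip F N n = 1 := by
      rw [hQn, ← Matrix.mul_assoc, clip_mul_clip (Or.inl hn), clip_self, Matrix.one_mul,
        clip_mul_clip (Or.inl hn), clip_self]
    have e2 : clip F n N * Qk * clip F N n = clip F n k * clip F k n := by
      rw [hQk, ← Matrix.mul_assoc, clip_mul_clip (Or.inl hn), Matrix.mul_assoc,
        clip_mul_clip (Or.inl hk)]
    rw [Matrix.mul_sub, Matrix.sub_mul, e1, e2]
  have ek : 1 - clip F k n * clip F n k = -clip F k N * (Qn - Qk) * clip F N k := by
    have e1 : clip F k N * Qk * clip F N k = 1 := by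
      rw [hQk, ← Matrix.mul_assoc, clip_mul_clip (Or.inl hk), clip_self, Matrix.one_mul,
        clip_mul_clip (Or.inl hk), clip_self]
    have e2 : clip F k N * Qn * clip F N k = clip F k n * clip F n k := by
      rw [hQn, ← Matrix.mul_assoc, clip_mul_clip (Or.inl hk), Matrix.mul_assoc,
        clip_mul_clip (Or.inl hn)]
    rw [Matrix.mul_sub, Matrix.sub_mul, Matrix.neg_mul, Matrix.neg_mul, Matrix.neg_mul,
      Matrix.neg_mul, e1, e2]
    abel
  constructor
  · refine le_trans ?_ h3
    rw [en]
    exact Nat.cast_le.mpr (Matrix.rank_sandwich_le _ _ _)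
  · refine le_trans ?_ h3
    rw [ek]
    exact Nat.cast_le.mpr (Matrix.rank_sandwich_le _ _ _)

lemma RankStable.intertwinerStable [Fintype σ] {ι : Type} {P : ι → FreeAlgebra F σ}
    (h : RankStable F P) : IntertwinerStable F P := by
  intro ε hε
  by_cases hP : ∀ i, FreeAlgebra.algebraMapInv (P i) = 0
  · obtain ⟨δ, hδ, H⟩ := h (ε / (Fintype.card σ + 1)) (by positivity)
    refine ⟨δ, hδ, fun n hn A hA => ?_⟩
    have hn' : (0 : ℝ) < n := by exact_mod_cast hn
    obtain ⟨k, -, B, hB, hAB⟩ := H n hn A hA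
    obtain ⟨l, T, S, S', hT, hS, hS1, hS2⟩ := exists_intertwiner_of_constantCoeff_eq_zero hP A B hB
    set q : ℝ := ε / (Fintype.card σ + 1) with hq
    have hq0 : 0 < q := by positivity
    have hqε : (Fintype.card σ + 1) * q = ε := by rw [hq]; field_simp
    refine ⟨l, T, S, S', hT, fun j => ?_, ?_, ?_⟩
    · have h1 : ((S * A j - T j * S).rank : ℝ) ≤ padRankDiff (A j) (B j) := by
        exact_mod_cast hS j
      have h2 := hAB j
      have h3 : q * n ≤ ε * n := by
        rw [← hqε]
        gcongr
        nlinarith [(Nat.cast_nonneg (Fintype.card σ) : (0 : ℝ) ≤ _)]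
      linarith
    · rw [hS1]
      simp only [sub_self, Matrix.rank_zero, Nat.cast_zero]
      positivity
    · have h1 : ((1 - S * S').rank : ℝ) ≤ ∑ j, (padRankDiff (A j) (B j) : ℝ) := by
        exact_mod_cast hS2
      have h2 : ∑ j, (padRankDiff (A j) (B j) : ℝ) ≤ ∑ _j : σ, q * n :=
        Finset.sum_le_sum fun j _ => (hAB j).le
      rw [Finset.sum_const, Finset.card_univ, nsmul_eq_mul] at h2
      have h3 : 0 < q * n := by positivity
      rw [← hqε]
      linarith
  · push Not at hP
    obtain ⟨i, hi⟩ := hP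
    obtain ⟨c, hc⟩ := exists_rank_one_sub_clip_le hi
    set q : ℝ := ε / (2 * (c + 1)) with hq
    have hq0 : 0 < q := by positivity
    have hqε : 2 * (c + 1) * q = ε := by rw [hq]; field_simp
    obtain ⟨δ, hδ, H⟩ := h q hq0
    refine ⟨min δ (ε / 2), by positivity, fun n hn A hA => ?_⟩
    have hn' : (0 : ℝ) < n := by exact_mod_cast hn
    have b1 : min δ (ε / 2) * n ≤ δ * n := by gcongr; exact min_le_left _ _
    have b2 : min δ (ε / 2) * n ≤ ε / 2 * n := by gcongr; exact min_le_right _ _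
    obtain ⟨k, -, B, hB, hAB⟩ := H n hn A fun i => (hA i).trans_le b1
    obtain ⟨h1, h2⟩ := hc n k A B (q * n) (hB i) fun j => (hAB j).le
    have h3 := hA i
    have h4 : 0 < q * n := by positivity
    have h5 : c * (q * n) + q * n = ε / 2 * n := by rw [← hqε]; ring
    have h6 : 0 ≤ c * (q * n) := by positivity
    refine ⟨k, B, clip F k n, clip F n k, hB, fun j => ?_, by linarith, by linarith⟩
    have h7 : ((clip F k n * A j - B j * clip F k n).rank : ℝ) ≤ padRankDiff (A j) (B j) := by
      exact_mod_cast rank_clip_mul_sub_le_padRankDiff (A j) (B j)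
    have h8 := hAB j
    linarith

lemma rankStable_iff_intertwinerStable [Fintype σ] {ι : Type} {P : ι → FreeAlgebra F σ} :
    RankStable F P ↔ IntertwinerStable F P :=
  ⟨RankStable.intertwinerStable, IntertwinerStable.rankStable⟩

end OfRankStable

section Blocks

variable {F : Type} [Field F] {m : ℕ}

/-- The inclusion of the `i`-th block `F^k → F^(k m)`. -/
def blockIncl (F : Type) [Field F] {m : ℕ} (k : ℕ) (i : Fin m) :
    Matrix (Fin (k * m)) (Fin k) F :=
  Matrix.of fun a b => if a = finProdFinEquiv (b, i) then 1 else 0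

lemma blockIncl_transpose_mul (k : ℕ) (i j : Fin m) :
    (blockIncl F k i)ᵀ * blockIncl F k j = if i = j then 1 else 0 := by
  ext a b
  rw [Matrix.mul_apply]
  simp only [blockIncl, Matrix.transpose_apply, Matrix.of_apply, ite_mul, one_mul, zero_mul,
    Finset.sum_ite_eq', Finset.mem_univ, if_true]
  simp only [EmbeddingLike.apply_eq_iff_eq, Prod.mk.injEq]
  split_ifs <;> simp_all [Matrix.one_apply]

lemma sum_blockIncl_mul_transpose (k : ℕ) :
    ∑ i : Fin m, blockIncl F k i * (blockIncl F k i)ᵀ = 1 := by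
  ext a b
  obtain ⟨⟨a, i⟩, rfl⟩ := finProdFinEquiv.surjective a
  obtain ⟨⟨b, j⟩, rfl⟩ := finProdFinEquiv.surjective b
  simp only [Matrix.sum_apply, Matrix.mul_apply, blockIncl, Matrix.transpose_apply,
    Matrix.of_apply, Matrix.one_apply, EmbeddingLike.apply_eq_iff_eq, Prod.mk.injEq]
  rw [Finset.sum_eq_single i, Finset.sum_eq_single a]
  · simp [eq_comm]
  · intro c _ hc; simp [hc.symm]
  · simp
  · intro c _ hc; simp [hc.symm]
  · simp

/-- The block diagonal matrix with `m` diagonal blocks equal to `M`. -/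
def amplify (m : ℕ) {a b : ℕ} (M : Matrix (Fin a) (Fin b) F) :
    Matrix (Fin (a * m)) (Fin (b * m)) F :=
  ∑ i : Fin m, blockIncl F a i * M * (blockIncl F b i)ᵀ

lemma amplify_mul_blockIncl {a b : ℕ} (M : Matrix (Fin a) (Fin b) F) (i : Fin m) :
    amplify m M * blockIncl F b i = blockIncl F a i * M := by
  rw [amplify, Matrix.sum_mul, Finset.sum_eq_single i]
  · rw [Matrix.mul_assoc, blockIncl_transpose_mul, if_pos rfl, Matrix.mul_one]
  · intro j _ hj
    rw [Matrix.mul_assoc, blockIncl_transpose_mul, if_neg hj, Matrix.mul_zero]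
  · simp

lemma transpose_mul_amplify {a b : ℕ} (M : Matrix (Fin a) (Fin b) F) (i : Fin m) :
    (blockIncl F a i)ᵀ * amplify m M = M * (blockIncl F b i)ᵀ := by
  rw [amplify, Matrix.mul_sum, Finset.sum_eq_single i]
  · rw [← Matrix.mul_assoc, ← Matrix.mul_assoc, blockIncl_transpose_mul, if_pos rfl,
      Matrix.one_mul]
  · intro j _ hj
    rw [← Matrix.mul_assoc, ← Matrix.mul_assoc, blockIncl_transpose_mul, if_neg hj.symm,
      Matrix.zero_mul, Matrix.zero_mul]
  · simp

lemma amplify_mul {a b c : ℕ} (M : Matrix (Fin a) (Fin b) F) (N : Matrix (Fin b) (Fin c) F) :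
    amplify m (M * N) = amplify m M * amplify m N := by
  conv_rhs => rw [amplify.eq_def (M := N), Matrix.mul_sum]
  refine Finset.sum_congr rfl fun i _ => ?_
  rw [← Matrix.mul_assoc, ← Matrix.mul_assoc, ← Matrix.mul_assoc (amplify m M),
    amplify_mul_blockIncl]

lemma amplify_one {a : ℕ} : amplify m (1 : Matrix (Fin a) (Fin a) F) = 1 := by
  simp only [amplify, Matrix.mul_one, sum_blockIncl_mul_transpose]

lemma amplify_sub {a b : ℕ} (M N : Matrix (Fin a) (Fin b) F) :
    amplify m (M - N) = amplify m M - amplify m N := by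
  simp only [amplify, Matrix.mul_sub, Matrix.sub_mul, Finset.sum_sub_distrib]

@[simp] lemma amplify_zero {a b : ℕ} : amplify m (0 : Matrix (Fin a) (Fin b) F) = 0 := by
  simp [amplify]

lemma rank_sum_fin_le {α β : Type} [Fintype β] (M : Fin m → Matrix α β F) {c : ℕ}
    (h : ∀ i, (M i).rank ≤ c) : (∑ i, M i).rank ≤ m * c := by
  refine (Matrix.rank_sum_le' _ _).trans ((Finset.sum_le_sum fun i _ => h i).trans ?_)
  simp

lemma rank_amplify_le {a b : ℕ} (M : Matrix (Fin a) (Fin b) F) :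
    (amplify m M).rank ≤ m * M.rank :=
  rank_sum_fin_le _ fun _ => Matrix.rank_sandwich_le _ _ _

lemma evalPoly_amplify {σ : Type} {k : ℕ} (T : σ → Matrix (Fin k) (Fin k) F)
    (p : FreeAlgebra F σ) :
    evalPoly p (fun j => amplify m (T j)) = amplify m (evalPoly p T) := by
  have h : ∀ i : Fin m, blockIncl F k i * evalPoly p T
      = evalPoly p (fun j => amplify m (T j)) * blockIncl F k i := fun i =>
    mul_evalPoly_eq (fun j => (amplify_mul_blockIncl (T j) i).symm) p
  rw [amplify]
  simp only [h, Matrix.mul_assoc]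
  rw [← Matrix.mul_sum, sum_blockIncl_mul_transpose, Matrix.mul_one]

lemma blockIncl_unit_mul_amplify {a b : ℕ} (M : Matrix (Fin a) (Fin b) F) (i j : Fin m) :
    blockIncl F a i * (blockIncl F a j)ᵀ * amplify m M
      = amplify m M * (blockIncl F b i * (blockIncl F b j)ᵀ) := by
  rw [Matrix.mul_assoc, transpose_mul_amplify, ← Matrix.mul_assoc, ← Matrix.mul_assoc,
    amplify_mul_blockIncl]

end Blocks

section MatrixAlgebra

variable {F : Type} [Field F] {d r m : ℕ} {P : Fin r → FreeAlgebra F (Fin d)}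

lemma evalPoly_lift_ι {σ τ : Type} {n : ℕ} (f : σ → τ) (Y : τ → Matrix (Fin n) (Fin n) F)
    (p : FreeAlgebra F σ) :
    evalPoly (FreeAlgebra.lift F (fun j => FreeAlgebra.ι F (f j)) p) Y
      = evalPoly p (fun j => Y (f j)) := by
  induction p with
  | grade0 c => simp [evalPoly]
  | grade1 j => simp [evalPoly]
  | mul p q hp hq => simp [evalPoly_mul, hp, hq]
  | add p q hp hq => simp [evalPoly_add, hp, hq]

/-- The relations of the matrix algebra evaluated at a tuple satisfy a predicate as soon as
each of the four families of relations does. -/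
lemma forall_evalPoly_matrixAlgebraRels {n : ℕ} {p : Matrix (Fin n) (Fin n) F → Prop}
    (Y : Fin d ⊕ (Fin m × Fin m) → Matrix (Fin n) (Fin n) F) :
    (∀ t, p (evalPoly (matrixAlgebraRels F (m := m) P t) Y)) ↔
      (∀ i, p (evalPoly (P i) fun j => Y (Sum.inl j))) ∧
      p (∑ i, Y (Sum.inr (i, i)) - 1) ∧
      (∀ i j k l, p (Y (Sum.inr (i, j)) * Y (Sum.inr (k, l))
        - if j = k then Y (Sum.inr (i, l)) else 0)) ∧
      ∀ i j k, p (Y (Sum.inr (i, j)) * Y (Sum.inl k) - Y (Sum.inl k) * Y (Sum.inr (i, j))) := by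
  have h1 : ∀ i, evalPoly (matrixAlgebraRels F (m := m) P (Sum.inl i)) Y
      = evalPoly (P i) fun j => Y (Sum.inl j) := fun i => evalPoly_lift_ι _ _ _
  have h2 : ∀ u, evalPoly (matrixAlgebraRels F (m := m) P (Sum.inr (Sum.inl u))) Y
      = ∑ i, Y (Sum.inr (i, i)) - 1 := fun u => by
    simp [matrixAlgebraRels, evalPoly]
  have h3 : ∀ i j k l, evalPoly (matrixAlgebraRels F (m := m) P
      (Sum.inr (Sum.inr (Sum.inl ((i, j), (k, l)))))) Y
      = Y (Sum.inr (i, j)) * Y (Sum.inr (k, l))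
        - if j = k then Y (Sum.inr (i, l)) else 0 := fun i j k l => by
    by_cases h : j = k <;> simp [matrixAlgebraRels, evalPoly, h]
  have h4 : ∀ i j k, evalPoly (matrixAlgebraRels F (m := m) P
      (Sum.inr (Sum.inr (Sum.inr ((i, j), k))))) Y
      = Y (Sum.inr (i, j)) * Y (Sum.inl k) - Y (Sum.inl k) * Y (Sum.inr (i, j)) :=
    fun i j k => by simp [matrixAlgebraRels, evalPoly]
  simp only [Sum.forall, Prod.forall, h1, h2, h3, h4, Unique.forall_iff]

/-- The standard tuple in `M_(km)(F) = M_m(M_k(F))` attached to a tuple in `M_k(F)`. -/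
def amplifyTuple (m : ℕ) {k : ℕ} (T : Fin d → Matrix (Fin k) (Fin k) F) :
    Fin d ⊕ (Fin m × Fin m) → Matrix (Fin (k * m)) (Fin (k * m)) F :=
  Sum.elim (fun j => amplify m (T j)) fun p => blockIncl F k p.1 * (blockIncl F k p.2)ᵀ

lemma forall_evalPoly_amplifyTuple {k : ℕ} {p : Matrix (Fin (k * m)) (Fin (k * m)) F → Prop}
    (T : Fin d → Matrix (Fin k) (Fin k) F) (h0 : p 0)
    (hT : ∀ i, p (amplify m (evalPoly (P i) T))) :
    ∀ t, p (evalPoly (matrixAlgebraRels F (m := m) P t) (amplifyTuple m T)) := by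
  rw [forall_evalPoly_matrixAlgebraRels]
  simp only [amplifyTuple, Sum.elim_inl, Sum.elim_inr]
  refine ⟨fun i => ?_, ?_, fun i j k' l => ?_, fun i j k' => ?_⟩
  · rw [evalPoly_amplify]
    exact hT i
  · rwa [sum_blockIncl_mul_transpose, sub_self]
  · convert h0 using 1
    rw [sub_eq_zero, Matrix.mul_assoc, ← Matrix.mul_assoc (blockIncl F k j)ᵀ,
      blockIncl_transpose_mul]
    split_ifs <;> simp
  · convert h0 using 1
    rw [sub_eq_zero, blockIncl_unit_mul_amplify]

/-- Passing from an exact solution for the matrix algebra to its corner. -/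
lemma IntertwinerStable.of_matrixAlgebraRels (hm : 1 ≤ m)
    (h : IntertwinerStable F (matrixAlgebraRels F (m := m) P)) : IntertwinerStable F P := by
  intro ε hε
  have hm' : (0 : ℝ) < m := by exact_mod_cast hm
  obtain ⟨δ, hδ, H⟩ := h (ε / (2 * m)) (by positivity)
  refine ⟨δ, hδ, fun n hn A hA => ?_⟩
  have hn' : (0 : ℝ) < n := by exact_mod_cast hn
  obtain ⟨N, B, S, S', hB, hS, hS1, hS2⟩ := H (n * m) (by positivity) (amplifyTuple m A)
    (forall_evalPoly_amplifyTuple (p := fun M => (M.rank : ℝ) < δ * (n * m : ℕ)) A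
      (by simp only [Matrix.rank_zero]; push_cast; positivity) fun i => by
        have h1 : ((amplify m (evalPoly (P i) A)).rank : ℝ) ≤ m * (evalPoly (P i) A).rank := by
          exact_mod_cast rank_amplify_le _
        have h2 := mul_lt_mul_of_pos_left (hA i) hm'
        push_cast
        linarith)
  have hε' : ε / (2 * m) * ((n * m : ℕ) : ℝ) = ε / 2 * n := by
    push_cast
    field_simp
  rw [hε'] at hS1 hS2
  simp only [hε'] at hS
  have hB' := (forall_evalPoly_matrixAlgebraRels (p := fun M => M = 0) B).mp hB
  obtain ⟨hBP, -, hBm, hBc⟩ := hB'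
  let o : Fin m := ⟨0, hm⟩
  set E := B (Sum.inr (o, o)) with hE
  have hEE : E * E = E := by simpa [sub_eq_zero] using hBm o o o o
  have hEc : ∀ j, E * B (Sum.inl j) = B (Sum.inl j) * E := fun j => sub_eq_zero.mp (hBc o o j)
  obtain ⟨k, R, L, G, K, hERL, hGR, hLK⟩ := E.exists_rank_factorization
  have hLR : L * R = 1 := by
    have h1 : G * (E * E) * K = G * E * K := by rw [hEE]
    have h2 : G * (E * E) * K = L * R := by
      rw [hERL]
      calc G * (R * L * (R * L)) * K = (G * R) * (L * R) * (L * K) := by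
            simp only [Matrix.mul_assoc]
        _ = L * R := by rw [hGR, hLK, Matrix.one_mul, Matrix.mul_one]
    rw [← h2, h1, hERL, ← Matrix.mul_assoc, hGR, Matrix.one_mul, hLK]
  have hLE : L * E = L := by rw [hERL, ← Matrix.mul_assoc, hLR, Matrix.one_mul]
  set u := blockIncl F n o with hu
  have huu : uᵀ * u = 1 := by rw [hu, blockIncl_transpose_mul, if_pos rfl]
  have hSe : ((S * (u * uᵀ) - E * S).rank : ℝ) < ε / 2 * n := hS (Sum.inr (o, o))
  refine ⟨k, fun j => L * B (Sum.inl j) * R, L * S * u, uᵀ * S' * R, fun i => ?_, fun j => ?_,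
    ?_, ?_⟩
  · have h1 := mul_evalPoly_eq (S := L) (A := fun j => B (Sum.inl j))
      (T := fun j => L * B (Sum.inl j) * R) (fun j => by
        rw [Matrix.mul_assoc, ← hERL, Matrix.mul_assoc, ← hEc, ← Matrix.mul_assoc, hLE]) (P i)
    rw [hBP, Matrix.mul_zero] at h1
    rw [← Matrix.mul_one (evalPoly _ _), ← hLR, ← Matrix.mul_assoc, ← h1, Matrix.zero_mul]
  · have h1 : ((S * amplify m (A j) - B (Sum.inl j) * S).rank : ℝ) < ε / 2 * n := hS (Sum.inl j)
    have e : L * S * u * A j - L * B (Sum.inl j) * R * (L * S * u)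
        = L * (S * amplify m (A j) - B (Sum.inl j) * S) * u := by
      have e1 : L * B (Sum.inl j) * R * (L * S * u) = L * (B (Sum.inl j) * S) * u := by
        calc L * B (Sum.inl j) * R * (L * S * u)
            = L * (B (Sum.inl j) * (R * L)) * S * u := by simp only [Matrix.mul_assoc]
          _ = L * (B (Sum.inl j) * S) * u := by
            rw [← hERL, ← hEc, ← Matrix.mul_assoc, hLE]
            simp only [Matrix.mul_assoc]
      rw [e1, Matrix.mul_sub, Matrix.sub_mul]
      simp only [Matrix.mul_assoc]
      rw [hu, amplify_mul_blockIncl]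
    have h2 : ((L * (S * amplify m (A j) - B (Sum.inl j) * S) * u).rank : ℝ)
        ≤ (S * amplify m (A j) - B (Sum.inl j) * S).rank := by
      exact_mod_cast Matrix.rank_sandwich_le L (S * amplify m (A j) - B (Sum.inl j) * S) u
    rw [e]
    nlinarith
  · have e : 1 - uᵀ * S' * R * (L * S * u)
        = uᵀ * (1 - S' * S) * u + uᵀ * S' * (S * (u * uᵀ) - E * S) * u := by
      have e1 : uᵀ * S' * R * (L * S * u) = uᵀ * S' * E * S * u := by
        rw [hERL]
        simp only [Matrix.mul_assoc]
      rw [e1]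
      simp only [Matrix.mul_sub, Matrix.sub_mul, Matrix.mul_one, Matrix.mul_assoc, huu]
      abel
    have h1 := Matrix.rank_add_le' (uᵀ * (1 - S' * S) * u)
      (uᵀ * S' * (S * (u * uᵀ) - E * S) * u)
    have h2 := Matrix.rank_sandwich_le uᵀ (1 - S' * S) u
    have h3 := Matrix.rank_sandwich_le (uᵀ * S') (S * (u * uᵀ) - E * S) u
    rw [← e] at h1
    have h4 : ((1 - uᵀ * S' * R * (L * S * u)).rank : ℝ)
        ≤ (1 - S' * S).rank + (S * (u * uᵀ) - E * S).rank := by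
      exact_mod_cast h1.trans (add_le_add h2 h3)
    linarith
  · have e : 1 - L * S * u * (uᵀ * S' * R)
        = L * (1 - S * S') * R - L * (S * (u * uᵀ) - E * S) * (S' * R) := by
      have e1 : L * (E * S) = L * S := by rw [← Matrix.mul_assoc, hLE]
      rw [Matrix.mul_sub L (S * (u * uᵀ)), e1]
      simp only [Matrix.mul_sub, Matrix.sub_mul, Matrix.mul_one, Matrix.mul_assoc, hLR]
      abel
    have h1 := Matrix.rank_sub_le' (L * (1 - S * S') * R)
      (L * (S * (u * uᵀ) - E * S) * (S' * R))
    have h2 := Matrix.rank_sandwich_le L (1 - S * S') R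
    have h3 := Matrix.rank_sandwich_le L (S * (u * uᵀ) - E * S) (S' * R)
    rw [← e] at h1
    have h4 : ((1 - L * S * u * (uᵀ * S' * R)).rank : ℝ)
        ≤ (1 - S * S').rank + (S * (u * uᵀ) - E * S).rank := by
      exact_mod_cast h1.trans (add_le_add h2 h3)
    linarith

/-- Approximate matrix units commuting approximately with a tuple `X` present `X` approximately
as the amplification of a tuple in the corner. -/
lemma exists_corner {n ρ : ℕ} (o : Fin m) (X : Fin d → Matrix (Fin n) (Fin n) F)
    (e : Fin m → Fin m → Matrix (Fin n) (Fin n) F)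
    (hsum : (∑ i, e i i - 1).rank ≤ ρ)
    (hmul : ∀ i j k l, (e i j * e k l - if j = k then e i l else 0).rank ≤ ρ)
    (hcomm : ∀ i j k, (e i j * X k - X k * e i j).rank ≤ ρ) :
    ∃ (k : ℕ) (A : Fin d → Matrix (Fin k) (Fin k) F) (L : Matrix (Fin k) (Fin n) F)
      (H : Matrix (Fin n) (Fin k) F) (S : Matrix (Fin (k * m)) (Fin n) F)
      (S' : Matrix (Fin n) (Fin (k * m)) F),
      L * H = 1 ∧ (∀ j, (L * X j - A j * L).rank ≤ 2 * ρ) ∧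
      (∀ j, (S * X j - amplify m (A j) * S).rank ≤ m * (2 * ρ)) ∧
      (∀ i j, (S * e i j - blockIncl F k i * (blockIncl F k j)ᵀ * S).rank ≤ m * ρ) ∧
      (1 - S' * S).rank ≤ m * (2 * ρ) + ρ ∧ (1 - S * S').rank ≤ m * (m * (2 * ρ)) := by
  set f := e o o with hf
  obtain ⟨k, R, L, G, H, hRL, hGR, hLH⟩ := f.exists_rank_factorization
  have hff : (f * f - f).rank ≤ ρ := by simpa using hmul o o o o
  have hLR : (L * R - 1).rank ≤ ρ := by
    have h1 : L * R - 1 = G * (f * f - f) * H := by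
      have h2 : G * (f * f) * H = L * R := by
        rw [hRL]
        calc G * (R * L * (R * L)) * H = (G * R) * (L * R) * (L * H) := by
              simp only [Matrix.mul_assoc]
          _ = L * R := by rw [hGR, hLH, Matrix.one_mul, Matrix.mul_one]
      have h3 : G * f * H = 1 := by
        rw [hRL, ← Matrix.mul_assoc, hGR, Matrix.one_mul, hLH]
      rw [Matrix.mul_sub, Matrix.sub_mul, h2, h3]
    rw [h1]
    exact (Matrix.rank_sandwich_le _ _ _).trans hff
  refine ⟨k, fun j => L * X j * R, L, H, ∑ a, blockIncl F k a * L * e o a,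
    ∑ a, e a o * R * (blockIncl F k a)ᵀ, hLH, fun j => ?_, fun j => ?_, fun i j => ?_, ?_, ?_⟩
  · have h1 : L * X j - L * X j * R * L
        = L * (f * X j - X j * f) - (L * R - 1) * (L * X j) := by
      simp only [hRL, Matrix.mul_sub, Matrix.sub_mul, Matrix.mul_assoc, Matrix.one_mul]
      abel
    have h2 := Matrix.rank_sub_le' (L * (f * X j - X j * f)) ((L * R - 1) * (L * X j))
    have h3 := Matrix.rank_mul_le_right L (f * X j - X j * f)
    have h4 := Matrix.rank_mul_le_left (L * R - 1) (L * X j)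
    have h5 : (f * X j - X j * f).rank ≤ ρ := hcomm o o j
    rw [h1]
    omega
  · have h1 : (∑ a, blockIncl F k a * L * e o a) * X j
          - amplify m (L * X j * R) * ∑ a, blockIncl F k a * L * e o a
        = ∑ a, blockIncl F k a * (L * ((e o a * X j - X j * e o a)
          - X j * (f * e o a - e o a))) := by
      rw [Matrix.sum_mul, Matrix.mul_sum, ← Finset.sum_sub_distrib]
      refine Finset.sum_congr rfl fun a _ => ?_
      rw [← Matrix.mul_assoc (amplify _ _), ← Matrix.mul_assoc (amplify _ _),
        amplify_mul_blockIncl]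
      simp only [hRL, Matrix.mul_sub, Matrix.mul_assoc]
      abel
    rw [h1]
    refine rank_sum_fin_le _ fun a => ?_
    refine (Matrix.rank_mul_le_right _ _).trans ((Matrix.rank_mul_le_right _ _).trans ?_)
    have h2 := Matrix.rank_sub_le' (e o a * X j - X j * e o a) (X j * (f * e o a - e o a))
    have h3 := Matrix.rank_mul_le_right (X j) (f * e o a - e o a)
    have h4 := hcomm o a j
    have h5 : (f * e o a - e o a).rank ≤ ρ := by simpa using hmul o o o a
    omega
  · have h1 : (∑ a, blockIncl F k a * L * e o a) * e i j
          - blockIncl F k i * (blockIncl F k j)ᵀ * ∑ a, blockIncl F k a * L * e o a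
        = ∑ a, blockIncl F k a * L * (e o a * e i j - if a = i then e o j else 0) := by
      have h2 : blockIncl F k i * (blockIncl F k j)ᵀ * ∑ a, blockIncl F k a * L * e o a
          = blockIncl F k i * L * e o j := by
        rw [Matrix.mul_sum, Finset.sum_eq_single j]
        · rw [Matrix.mul_assoc, ← Matrix.mul_assoc (blockIncl F k j)ᵀ,
            ← Matrix.mul_assoc (blockIncl F k j)ᵀ, blockIncl_transpose_mul, if_pos rfl,
            Matrix.one_mul, Matrix.mul_assoc]
        · intro b _ hb
          rw [Matrix.mul_assoc, ← Matrix.mul_assoc (blockIncl F k j)ᵀ,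
            ← Matrix.mul_assoc (blockIncl F k j)ᵀ, blockIncl_transpose_mul, if_neg hb.symm]
          simp
        · simp
      have h3 : ∑ a, blockIncl F k a * L * (if a = i then e o j else 0)
          = blockIncl F k i * L * e o j := by
        rw [Finset.sum_eq_single i]
        · simp
        · intro b _ hb; simp [hb]
        · simp
      simp only [Matrix.mul_sub, Finset.sum_sub_distrib]
      rw [h2, h3, Matrix.sum_mul]
      simp only [Matrix.mul_assoc]
    rw [h1]
    exact rank_sum_fin_le _ fun a => (Matrix.rank_mul_le_right _ _).trans (hmul o a i j)
  · have h1 : 1 - (∑ a, e a o * R * (blockIncl F k a)ᵀ) * ∑ a, blockIncl F k a * L * e o a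
        = -(∑ a, (e a o * (f * e o a - e o a) + (e a o * e o a - e a a)))
          - (∑ a, e a a - 1) := by
      have h2 : (∑ a, e a o * R * (blockIncl F k a)ᵀ) * ∑ a, blockIncl F k a * L * e o a
          = ∑ a, e a o * f * e o a := by
        rw [Matrix.sum_mul]
        refine Finset.sum_congr rfl fun a _ => ?_
        rw [Matrix.mul_sum, Finset.sum_eq_single a]
        · rw [Matrix.mul_assoc, ← Matrix.mul_assoc (blockIncl F k a)ᵀ,
            ← Matrix.mul_assoc (blockIncl F k a)ᵀ, blockIncl_transpose_mul, if_pos rfl,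
            Matrix.one_mul, hRL]
          simp only [Matrix.mul_assoc]
        · intro b _ hb
          rw [Matrix.mul_assoc, ← Matrix.mul_assoc (blockIncl F k a)ᵀ,
            ← Matrix.mul_assoc (blockIncl F k a)ᵀ, blockIncl_transpose_mul, if_neg hb.symm]
          simp
        · simp
      rw [h2]
      simp only [Matrix.mul_sub, Finset.sum_add_distrib, Finset.sum_sub_distrib, Matrix.mul_assoc]
      abel
    rw [h1]
    refine (Matrix.rank_sub_le' _ _).trans (add_le_add ?_ hsum)
    rw [Matrix.rank_neg']
    refine rank_sum_fin_le _ fun a => ?_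
    have h2 := Matrix.rank_add_le' (e a o * (f * e o a - e o a)) (e a o * e o a - e a a)
    have h3 := Matrix.rank_mul_le_right (e a o) (f * e o a - e o a)
    have h4 : (f * e o a - e o a).rank ≤ ρ := by simpa using hmul o o o a
    have h5 : (e a o * e o a - e a a).rank ≤ ρ := by simpa using hmul a o o a
    omega
  · have h1 : 1 - (∑ a, blockIncl F k a * L * e o a) * ∑ b, e b o * R * (blockIncl F k b)ᵀ
        = ∑ a, ∑ b, blockIncl F k a * ((if a = b then (1 : Matrix (Fin k) (Fin k) F) else 0) - L * (e o a * e b o) * R)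
          * (blockIncl F k b)ᵀ := by
      have h2 : (1 : Matrix (Fin (k * m)) (Fin (k * m)) F) = ∑ a : Fin m, ∑ b,
          blockIncl F k a * (if a = b then (1 : Matrix (Fin k) (Fin k) F) else 0) *
            (blockIncl F k b)ᵀ := by
        rw [← sum_blockIncl_mul_transpose]
        refine Finset.sum_congr rfl fun a _ => ?_
        rw [Finset.sum_eq_single a]
        · simp
        · intro b _ hb; simp [hb.symm]
        · simp
      conv_lhs => rw [h2]
      rw [Matrix.sum_mul, ← Finset.sum_sub_distrib]
      refine Finset.sum_congr rfl fun a _ => ?_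
      rw [Matrix.mul_sum, ← Finset.sum_sub_distrib]
      refine Finset.sum_congr rfl fun b _ => ?_
      simp only [Matrix.mul_sub, Matrix.sub_mul, Matrix.mul_assoc]
    rw [h1]
    refine rank_sum_fin_le _ fun a => rank_sum_fin_le _ fun b => ?_
    refine (Matrix.rank_sandwich_le _ _ _).trans ?_
    have h2 : ((if a = b then (1 : Matrix (Fin k) (Fin k) F) else 0) - L * (e o a * e b o) * R)
        = -(L * (e o a * e b o - if a = b then f else 0) * R
          + if a = b then (L * R - 1) * (L * R + 1) else 0) := by
      split_ifs
      · simp only [hRL, Matrix.mul_sub, Matrix.sub_mul, Matrix.mul_add, Matrix.mul_assoc,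
          Matrix.one_mul, Matrix.mul_one]
        abel
      · simp
    rw [h2, Matrix.rank_neg']
    have h3 := Matrix.rank_add_le' (L * (e o a * e b o - if a = b then f else 0) * R)
      (if a = b then (L * R - 1) * (L * R + 1) else 0)
    have h4 := Matrix.rank_sandwich_le L (e o a * e b o - if a = b then f else 0) R
    have h5 : (e o a * e b o - if a = b then f else 0).rank ≤ ρ := hmul o a b o
    have h6 : (if a = b then (L * R - 1) * (L * R + 1) else 0).rank ≤ ρ := by
      split_ifs
      · exact (Matrix.rank_mul_le_left _ _).trans hLR
      · simp
    omega

lemma IntertwinerStable.matrixAlgebraRels (hm : 1 ≤ m) (h : IntertwinerStable F P) :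
    IntertwinerStable F (matrixAlgebraRels F (m := m) P) := by
  intro ε hε
  have hm' : (0 : ℝ) < m := by exact_mod_cast hm
  obtain ⟨δ₀, hδ₀, H⟩ := h (ε / (2 * m)) (by positivity)
  choose c hc using fun i => exists_rank_intertwine_le (P i)
  set C : ℝ := ∑ i, (c i : ℝ) with hC
  have hC0 : 0 ≤ C := by positivity
  have hcC : ∀ i, (c i : ℝ) ≤ C := fun i =>
    Finset.single_le_sum (f := fun i => (c i : ℝ)) (fun _ _ => by positivity) (Finset.mem_univ i)
  set K : ℝ := 2 * m ^ 2 + 2 * m + 1 with hK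
  have hK0 : 0 < K := by positivity
  obtain ⟨δ, hδ, hδ1, hδ2, hδ3⟩ : ∃ δ : ℝ, 0 < δ ∧ (1 + 2 * C) * δ * (2 * m) ≤ δ₀ ∧
      K * δ ≤ 1 / 2 ∧ K * δ ≤ ε / 2 := by
    refine ⟨min (δ₀ / ((1 + 2 * C) * (2 * m))) (min (1 / 2) (ε / 2) / K), by positivity,
      ?_, ?_, ?_⟩
    · have h1 := min_le_left (δ₀ / ((1 + 2 * C) * (2 * m))) (min (1 / 2) (ε / 2) / K)
      rw [le_div_iff₀ (by positivity)] at h1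
      linarith
    all_goals
      have h1 := min_le_right (δ₀ / ((1 + 2 * C) * (2 * m))) (min (1 / 2) (ε / 2) / K)
      rw [le_div_iff₀ (by positivity), mul_comm] at h1
      refine h1.trans ?_
      first | exact min_le_left _ _ | exact min_le_right _ _
  refine ⟨δ, hδ, fun n hn Y hY => ?_⟩
  have hn' : (0 : ℝ) < n := by exact_mod_cast hn
  obtain ⟨hP, hsum, hmul, hcomm⟩ := (forall_evalPoly_matrixAlgebraRels
    (p := fun M => (M.rank : ℝ) < δ * n) Y).mp hY
  set ρ : ℕ := ⌊δ * n⌋₊ with hρdef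
  have hρ : (ρ : ℝ) ≤ δ * n := Nat.floor_le (by positivity)
  have hρ' : ∀ {x : ℕ}, (x : ℝ) < δ * n → x ≤ ρ := fun hx => Nat.le_floor hx.le
  obtain ⟨k, A, L, J, S, S', hLJ, hL, hSX, hSe, hS1, hS2⟩ := exists_corner ⟨0, hm⟩
    (fun j => Y (Sum.inl j)) (fun i j => Y (Sum.inr (i, j))) (hρ' hsum)
    (fun i j k l => hρ' (hmul i j k l)) (fun i j k => hρ' (hcomm i j k))
  have hkn : k ≤ n := by simpa [hLJ] using le_add_rank_one_sub_mul J L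
  have hkn' : (k : ℝ) ≤ n := by exact_mod_cast hkn
  have hS1' : ((1 - S' * S).rank : ℝ) ≤ (2 * m + 1) * ρ := by
    have : ((1 - S' * S).rank : ℝ) ≤ m * (2 * ρ) + ρ := by exact_mod_cast hS1
    linarith
  have hS2' : ((1 - S * S').rank : ℝ) ≤ 2 * m ^ 2 * ρ := by
    have : ((1 - S * S').rank : ℝ) ≤ m * (m * (2 * ρ)) := by exact_mod_cast hS2
    linarith
  have hρ0 : (0 : ℝ) ≤ ρ := by positivity
  have hKρ : K * ρ ≤ K * δ * n := by
    rw [mul_assoc]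
    gcongr
  have hKn1 : K * δ * n ≤ 1 / 2 * n := by gcongr
  have hKn2 : K * δ * n ≤ ε / 2 * n := by gcongr
  have hm2 : (0 : ℝ) ≤ 2 * m ^ 2 * ρ := by positivity
  have hm1 : (0 : ℝ) ≤ m * ρ := by positivity
  have hKexp : K * ρ = 2 * m ^ 2 * ρ + 2 * (m * ρ) + ρ := by rw [hK]; ring
  have hnk : (n : ℝ) ≤ 2 * m * k := by
    have h1 : (n : ℝ) ≤ k * m + (1 - S' * S).rank := by
      exact_mod_cast le_add_rank_one_sub_mul S S'
    linarith
  have hk0 : 0 < k := by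
    rcases Nat.eq_zero_or_pos k with h0 | h0
    · rw [h0] at hnk
      simp only [Nat.cast_zero, mul_zero] at hnk
      linarith
    · exact h0
  obtain ⟨l, T, V, V', hT, hV, hV1, hV2⟩ := H k hk0 A fun i => by
    have h1 := hc i n k (fun j => Y (Sum.inl j)) A L ((2 * ρ : ℕ) : ℝ)
      fun j => by exact_mod_cast hL j
    have e : evalPoly (P i) A = (L * evalPoly (P i) (fun j => Y (Sum.inl j))
        - (L * evalPoly (P i) (fun j => Y (Sum.inl j)) - evalPoly (P i) A * L)) * J := by
      rw [sub_sub_cancel, Matrix.mul_assoc, hLJ, Matrix.mul_one]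
    have h2 : (evalPoly (P i) A).rank ≤ (evalPoly (P i) (fun j => Y (Sum.inl j))).rank
        + (L * evalPoly (P i) (fun j => Y (Sum.inl j)) - evalPoly (P i) A * L).rank := by
      conv_lhs => rw [e]
      refine (Matrix.rank_mul_le_left _ _).trans ((Matrix.rank_sub_le' _ _).trans ?_)
      gcongr
      exact Matrix.rank_mul_le_right _ _
    have h3 : ((evalPoly (P i) A).rank : ℝ)
        ≤ (evalPoly (P i) (fun j => Y (Sum.inl j))).rank
        + (L * evalPoly (P i) (fun j => Y (Sum.inl j)) - evalPoly (P i) A * L).rank := by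
      exact_mod_cast h2
    have h4 := hP i
    have h5 : (c i : ℝ) * ((2 * ρ : ℕ) : ℝ) ≤ C * (2 * (δ * n)) := by
      push_cast
      gcongr
      exact hcC i
    have h6 : (1 + 2 * C) * δ * n ≤ (1 + 2 * C) * δ * (2 * m * k) := by gcongr
    have h7 : (1 + 2 * C) * δ * (2 * m) * k ≤ δ₀ * k := by gcongr
    linarith
  have hamp : ∀ {a b : ℕ} (M : Matrix (Fin a) (Fin b) F),
      (M.rank : ℝ) < ε / (2 * m) * k → ((amplify m M).rank : ℝ) < ε / 2 * n := by
    intro a b M hM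
    have h1 : ((amplify m M).rank : ℝ) ≤ m * M.rank := by exact_mod_cast rank_amplify_le M
    have h2 : (m : ℝ) * M.rank < m * (ε / (2 * m) * k) := by gcongr
    have h3 : (m : ℝ) * (ε / (2 * m) * k) = ε / 2 * k := by field_simp
    have h4 : ε / 2 * k ≤ ε / 2 * n := by gcongr
    linarith
  refine ⟨l * m, amplifyTuple m T, amplify m V * S, S' * amplify m V',
    forall_evalPoly_amplifyTuple (p := fun M => M = 0) T rfl fun i => by rw [hT, amplify_zero],
    ?_, ?_, ?_⟩
  · rintro (j | ⟨i, j⟩)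
    · have e : amplify m V * S * Y (Sum.inl j) - amplify m (T j) * (amplify m V * S)
          = amplify m V * (S * Y (Sum.inl j) - amplify m (A j) * S)
            + amplify m (V * A j - T j * V) * S := by
        simp only [amplify_sub, amplify_mul, Matrix.mul_sub, Matrix.sub_mul, Matrix.mul_assoc]
        abel
      have h1 := Matrix.rank_add_le' (amplify m V * (S * Y (Sum.inl j) - amplify m (A j) * S))
        (amplify m (V * A j - T j * V) * S)
      have h2 := (Matrix.rank_mul_le_right (amplify m V)
        (S * Y (Sum.inl j) - amplify m (A j) * S)).trans (hSX j)
      have h3 := Matrix.rank_mul_le_left (amplify m (V * A j - T j * V)) S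
      rw [← e] at h1
      have h4 : ((amplify m V * S * Y (Sum.inl j) - amplify m (T j) * (amplify m V * S)).rank : ℝ)
          ≤ m * (2 * ρ) + (amplify m (V * A j - T j * V)).rank := by
        exact_mod_cast h1.trans (add_le_add h2 h3)
      have h5 := hamp _ (hV j)
      change ((amplify m V * S * Y (Sum.inl j)
        - amplify m (T j) * (amplify m V * S)).rank : ℝ) < ε * n
      linarith
    · have e : amplify m V * S * Y (Sum.inr (i, j))
            - blockIncl F l i * (blockIncl F l j)ᵀ * (amplify m V * S)
          = amplify m V * (S * Y (Sum.inr (i, j))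
            - blockIncl F k i * (blockIncl F k j)ᵀ * S) := by
        rw [← Matrix.mul_assoc _ (amplify m V), blockIncl_unit_mul_amplify, Matrix.mul_sub]
        simp only [Matrix.mul_assoc]
      have h1 := (Matrix.rank_mul_le_right (amplify m V) (S * Y (Sum.inr (i, j))
            - blockIncl F k i * (blockIncl F k j)ᵀ * S)).trans (hSe i j)
      rw [← e] at h1
      have h2 : ((amplify m V * S * Y (Sum.inr (i, j))
          - blockIncl F l i * (blockIncl F l j)ᵀ * (amplify m V * S)).rank : ℝ) ≤ m * ρ := by
        exact_mod_cast h1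
      have h3 : 0 < ε / 2 * n := by positivity
      change ((amplify m V * S * Y (Sum.inr (i, j))
          - blockIncl F l i * (blockIncl F l j)ᵀ * (amplify m V * S)).rank : ℝ) < ε * n
      linarith
  · have e : 1 - S' * amplify m V' * (amplify m V * S)
        = (1 - S' * S) + S' * amplify m (1 - V' * V) * S := by
      simp only [amplify_sub, amplify_mul, amplify_one, Matrix.mul_sub, Matrix.sub_mul,
        Matrix.mul_assoc, Matrix.one_mul]
      abel
    have h1 := Matrix.rank_add_le' (1 - S' * S) (S' * amplify m (1 - V' * V) * S)
    have h2 := Matrix.rank_sandwich_le S' (amplify m (1 - V' * V)) S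
    rw [← e] at h1
    have h3 : ((1 - S' * amplify m V' * (amplify m V * S)).rank : ℝ)
        ≤ (1 - S' * S).rank + (amplify m (1 - V' * V)).rank := by
      exact_mod_cast h1.trans (add_le_add le_rfl h2)
    have h4 := hamp _ hV1
    linarith
  · have e : 1 - amplify m V * S * (S' * amplify m V')
        = amplify m (1 - V * V') + amplify m V * (1 - S * S') * amplify m V' := by
      simp only [amplify_sub, amplify_mul, amplify_one, Matrix.mul_sub, Matrix.sub_mul,
        Matrix.mul_assoc, Matrix.one_mul]
      abel
    have h1 := Matrix.rank_add_le' (amplify m (1 - V * V'))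
      (amplify m V * (1 - S * S') * amplify m V')
    have h2 := Matrix.rank_sandwich_le (amplify m V) (1 - S * S') (amplify m V')
    rw [← e] at h1
    have h3 : ((1 - amplify m V * S * (S' * amplify m V')).rank : ℝ)
        ≤ (amplify m (1 - V * V')).rank + (1 - S * S').rank := by
      exact_mod_cast h1.trans (add_le_add le_rfl h2)
    have h4 := hamp _ hV2
    linarith

end MatrixAlgebra

/-- **Matrix algebras preserve rank-stability.** Suppose the system `P` admits an exact
solution by matrices of some positive size, and let `m ≥ 1`. Then the presentation of
`M_m(A)` (where `A` is the algebra presented by `P`) is rank-stable if and only if the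
presentation of `A` is rank-stable. -/
theorem stmt5_matrix_algebra_rank_stable_iff
    (F : Type) [Field F] (d r m : ℕ) (hm : 1 ≤ m)
    (P : Fin r → FreeAlgebra F (Fin d))
    (hPrep : ∃ n : ℕ, 0 < n ∧ ∃ A : Fin d → Matrix (Fin n) (Fin n) F,
      ∀ i, evalPoly (P i) A = 0) :
    RankStable F (matrixAlgebraRels F (m := m) P) ↔ RankStable F P := by
  rw [rankStable_iff_intertwinerStable, rankStable_iff_intertwinerStable]
  exact ⟨IntertwinerStable.of_matrixAlgebraRels hm, IntertwinerStable.matrixAlgebraRels hm⟩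
end
end

section
/- Instability criterion: let F be a field and let A = F⟨x_1,…,x_d⟩/⟨P_1,…,P_r⟩ be a finitely presented F-algebra. Suppose there is a two-sided ideal I of A such that: (i) I is finitely generated as a left ideal of A; (ii) the quotient algebra A/I is amenable; and (iii) A/I has no nonzero finite-dimensional representation, i.e., every finite-dimensional (left) A/I-module is zero. Then the presentation F⟨x_1,…,x_d⟩/⟨P_1,…,P_r⟩ is not rank-stable. -/
open Matrix

noncomputable section

/-- An `F`-algebra `B` is amenable (with respect to some finite generating set `g`, with
`S = F + Fg_1 + ⋯ + Fg_k`) if for every `ε > 0` there is a finite-dimensional subspace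
`V ≤ B` with `dim(SV + V) < (1 + ε)·dim V`. -/
def IsAmenableAlgebra (F : Type) [Field F] (B : Type) [Ring B] [Algebra F B] : Prop :=
  ∃ (k : ℕ) (g : Fin k → B), Algebra.adjoin F (Set.range g) = ⊤ ∧
    ∀ ε : ℝ, 0 < ε →
      ∃ V : Submodule F B, FiniteDimensional F V ∧
        FiniteDimensional F ↥(Submodule.span F ({1} ∪ Set.range g) * V + V) ∧
        ((Module.finrank F ↥(Submodule.span F ({1} ∪ Set.range g) * V + V) : ℝ) <
          (1 + ε) * (Module.finrank F V : ℝ))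

namespace LinearMap

variable {F X Y Z : Type*} [Field F] [AddCommGroup X] [Module F X] [AddCommGroup Y] [Module F Y]
  [AddCommGroup Z] [Module F Z]

/-- The rank of a linear map with finite-dimensional source, as a natural number. -/
def natRank (f : X →ₗ[F] Y) : ℕ := Module.finrank F (range f)

lemma natRank_zero : natRank (0 : X →ₗ[F] Y) = 0 := by
  rw [natRank, range_zero, finrank_bot]

lemma natRank_neg (f : X →ₗ[F] Y) : natRank (-f) = natRank f := by
  rw [natRank, range_neg, natRank]

lemma natRank_comp_le_left [FiniteDimensional F Y] (g : Y →ₗ[F] Z) (f : X →ₗ[F] Y) :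
    natRank (g ∘ₗ f) ≤ natRank g :=
  Submodule.finrank_mono (range_comp_le_range f g)

variable [FiniteDimensional F X]

lemma natRank_add_le (f g : X →ₗ[F] Y) : natRank (f + g) ≤ natRank f + natRank g :=
  (Submodule.finrank_mono (range_add_le f g)).trans
    (Submodule.finrank_add_le_finrank_add_finrank _ _)

lemma natRank_sub_le (f g : X →ₗ[F] Y) : natRank (f - g) ≤ natRank f + natRank g := by
  rw [sub_eq_add_neg, ← natRank_neg g]
  exact natRank_add_le f (-g)

lemma natRank_sum_le {η : Type*} (s : Finset η) (f : η → X →ₗ[F] Y) :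
    natRank (∑ k ∈ s, f k) ≤ ∑ k ∈ s, natRank (f k) :=
  Finset.le_sum_of_subadditive _ natRank_zero.le natRank_add_le s f

lemma natRank_comp_le_right (g : Y →ₗ[F] Z) (f : X →ₗ[F] Y) : natRank (g ∘ₗ f) ≤ natRank f := by
  rw [natRank, range_comp]
  exact Submodule.finrank_map_le g (range f)

lemma natRank_eq_of_ker_eq {f : X →ₗ[F] Y} {g : X →ₗ[F] Z} (h : ker f = ker g) :
    natRank f = natRank g := by
  have hf := finrank_range_add_finrank_ker f
  have hg := finrank_range_add_finrank_ker g
  rw [h] at hf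
  unfold natRank
  omega

/-- If a map `i` vanishes on the common kernel of finitely many maps `f k ∘ i`, its rank is at most
the sum of their ranks. -/
lemma natRank_le_sum_natRank_comp {η : Type*} [Fintype η] (i : X →ₗ[F] Y) (f : η → Y →ₗ[F] Z)
    (h : ∀ y, (∀ k, f k y = 0) → y = 0) : natRank i ≤ ∑ k, natRank (f k ∘ₗ i) := by
  classical
  have hker : ker i = ker (∑ k, single F (fun _ : η => Z) k ∘ₗ (f k ∘ₗ i)) := by
    ext x
    have hx : (∑ k, single F (fun _ : η => Z) k ∘ₗ (f k ∘ₗ i)) x = fun k => f k (i x) := by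
      ext k
      simp [Finset.sum_apply, Pi.single_apply]
    rw [mem_ker, mem_ker, hx]
    refine ⟨fun h0 => by ext k; simp [h0], fun h0 => h _ fun k => congrFun h0 k⟩
  rw [natRank_eq_of_ker_eq hker]
  exact (natRank_sum_le _ _).trans (Finset.sum_le_sum fun k _ => natRank_comp_le_right _ _)

/-- If `i` almost intertwines the tuples `T` and `T'`, then it almost intertwines their images under
a fixed noncommutative polynomial. -/
lemma exists_natRank_intertwiner_le {σ : Type*} [Fintype σ] (Q : FreeAlgebra F σ) :
    ∃ C : ℕ, ∀ {X Y : Type} [AddCommGroup X] [Module F X] [AddCommGroup Y] [Module F Y]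
      [FiniteDimensional F X] (i : X →ₗ[F] Y) (T : σ → Module.End F X) (T' : σ → Module.End F Y),
      natRank (i ∘ₗ FreeAlgebra.lift F T Q - FreeAlgebra.lift F T' Q ∘ₗ i) ≤
        C * ∑ l, natRank (i ∘ₗ T l - T' l ∘ₗ i) := by
  induction Q using FreeAlgebra.induction with
  | grade0 c =>
    refine ⟨0, fun i T T' => ?_⟩
    have : i ∘ₗ FreeAlgebra.lift F T (algebraMap F _ c) -
        FreeAlgebra.lift F T' (algebraMap F _ c) ∘ₗ i = 0 := by
      ext x
      simp [Module.algebraMap_end_apply]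
    rw [this, natRank_zero]
    exact Nat.zero_le _
  | grade1 l =>
    refine ⟨1, fun i T T' => ?_⟩
    simp only [FreeAlgebra.lift_ι_apply, one_mul]
    exact Finset.single_le_sum (f := fun l => natRank (i ∘ₗ T l - T' l ∘ₗ i))
      (fun _ _ => Nat.zero_le _) (Finset.mem_univ l)
  | mul a b ha hb =>
    obtain ⟨Ca, ha⟩ := ha
    obtain ⟨Cb, hb⟩ := hb
    refine ⟨Ca + Cb, fun i T T' => ?_⟩
    have : i ∘ₗ FreeAlgebra.lift F T (a * b) - FreeAlgebra.lift F T' (a * b) ∘ₗ i =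
        (i ∘ₗ FreeAlgebra.lift F T a - FreeAlgebra.lift F T' a ∘ₗ i) ∘ₗ FreeAlgebra.lift F T b +
        FreeAlgebra.lift F T' a ∘ₗ
          (i ∘ₗ FreeAlgebra.lift F T b - FreeAlgebra.lift F T' b ∘ₗ i) := by
      ext x
      simp
    rw [this, add_mul]
    exact (natRank_add_le _ _).trans (add_le_add ((natRank_comp_le_left _ _).trans (ha i T T'))
      ((natRank_comp_le_right _ _).trans (hb i T T')))
  | add a b ha hb =>
    obtain ⟨Ca, ha⟩ := ha
    obtain ⟨Cb, hb⟩ := hb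
    refine ⟨Ca + Cb, fun i T T' => ?_⟩
    have : i ∘ₗ FreeAlgebra.lift F T (a + b) - FreeAlgebra.lift F T' (a + b) ∘ₗ i =
        (i ∘ₗ FreeAlgebra.lift F T a - FreeAlgebra.lift F T' a ∘ₗ i) +
          (i ∘ₗ FreeAlgebra.lift F T b - FreeAlgebra.lift F T' b ∘ₗ i) := by
      ext x
      simp
      abel
    rw [this, add_mul]
    exact (natRank_add_le _ _).trans (add_le_add (ha i T T') (hb i T T'))

end LinearMap

open LinearMap

section Matrices

variable {F : Type} [Field F]

lemma natRank_toLin' {m n : ℕ} (M : Matrix (Fin m) (Fin n) F) : natRank M.toLin' = M.rank := by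
  rw [natRank, Matrix.rank, Matrix.toLin'_apply']

lemma toLin'_evalPoly {σ : Type} {n : ℕ} (Q : FreeAlgebra F σ)
    (A : σ → Matrix (Fin n) (Fin n) F) :
    (evalPoly Q A).toLin' = FreeAlgebra.lift F (fun j => (A j).toLin') Q := by
  have : (Matrix.toLinAlgEquiv' (R := F) (n := Fin n)).toAlgHom.comp (FreeAlgebra.lift F A) =
      FreeAlgebra.lift F (fun j => (A j).toLin') := by
    ext j : 2
    simp only [AlgHom.comp_apply, Function.comp_apply, FreeAlgebra.lift_ι_apply]
    rfl
  exact DFunLike.congr_fun this Q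

/-- The truncated identity matrix. -/
def truncatedId (F : Type) [Field F] (m n : ℕ) : Matrix (Fin m) (Fin n) F :=
  Matrix.of fun a b => if (a : ℕ) = b then 1 else 0

lemma truncatedId_mul_apply {m n : ℕ} {o : Type} (A : Matrix (Fin n) o F) (a : Fin m) (b : o) :
    (truncatedId F m n * A) a b = if h : (a : ℕ) < n then A ⟨a, h⟩ b else 0 := by
  simp only [truncatedId, Matrix.mul_apply, Matrix.of_apply, ite_mul, one_mul, zero_mul]
  split_ifs with h
  · rw [Finset.sum_eq_single ⟨a, h⟩]
    · simp
    · intro c _ hc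
      rw [if_neg fun hac => hc (Fin.ext hac.symm)]
    · simp
  · exact Finset.sum_eq_zero fun c _ => if_neg fun hac => h (by omega)

lemma mul_truncatedId_apply {m n : ℕ} {o : Type} (A : Matrix o (Fin m) F) (a : o) (b : Fin n) :
    (A * truncatedId F m n) a b = if h : (b : ℕ) < m then A a ⟨b, h⟩ else 0 := by
  simp only [truncatedId, Matrix.mul_apply, Matrix.of_apply, mul_ite, mul_one, mul_zero]
  split_ifs with h
  · rw [Finset.sum_eq_single ⟨b, h⟩]
    · simp
    · intro c _ hc
      rw [if_neg fun hac => hc (Fin.ext hac)]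
    · simp
  · exact Finset.sum_eq_zero fun c _ => if_neg fun hac => h (by omega)

lemma rank_intertwiner_le_padRankDiff {n n' : ℕ} (A : Matrix (Fin n) (Fin n) F)
    (B : Matrix (Fin n') (Fin n') F) :
    (truncatedId F n' n * A - B * truncatedId F n' n).rank ≤ padRankDiff A B := by
  have : truncatedId F n' n * A - B * truncatedId F n' n =
      (padTo (max n n') A - padTo (max n n') B).submatrix
        (Fin.castLE (le_max_right n n')) (Fin.castLE (le_max_left n n')) := by
    ext a b
    simp [truncatedId_mul_apply, mul_truncatedId_apply, padTo]
  rw [this]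
  exact Matrix.rank_submatrix_le _ _ _

lemma rank_sub_compression_le_padRankDiff {n n' : ℕ} (A : Matrix (Fin n) (Fin n) F)
    (B : Matrix (Fin n') (Fin n') F) :
    (A - truncatedId F n n' * (B * truncatedId F n' n)).rank ≤ padRankDiff A B := by
  have : A - truncatedId F n n' * (B * truncatedId F n' n) =
      (padTo (max n n') A - padTo (max n n') B).submatrix
        (Fin.castLE (le_max_left n n')) (Fin.castLE (le_max_left n n')) := by
    ext a b
    simp only [Matrix.sub_apply, Matrix.submatrix_apply, truncatedId_mul_apply,
      mul_truncatedId_apply, padTo, Matrix.of_apply, Fin.val_castLE]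
    grind
  rw [this]
  exact Matrix.rank_submatrix_le _ _ _

end Matrices

section Descent

variable {F R B : Type} [Field F] [Ring R] [Algebra F R] [Ring B] [Algebra F B]

/-- An algebra homomorphism killing the kernel of a surjection factors through it. -/
lemma AlgHom.exists_comp_eq_of_surjective {E : Type*} [Ring E] [Algebra F E] (f : R →ₐ[F] B)
    (hf : Function.Surjective f) (ρ : R →ₐ[F] E) (h : ∀ x, f x = 0 → ρ x = 0) :
    ∃ g : B →ₐ[F] E, g.comp f = ρ := by
  let g : (R ⧸ RingHom.ker f) →ₐ[F] E := Ideal.Quotient.liftₐ _ ρ h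
  let e := Ideal.quotientKerAlgEquivOfSurjective hf
  refine ⟨g.comp e.symm.toAlgHom, AlgHom.ext fun x => ?_⟩
  have : e.symm (f x) = Ideal.Quotient.mk _ x := by
    rw [AlgEquiv.symm_apply_eq]
    rfl
  change g (e.symm (f x)) = ρ x
  rw [this]
  rfl

lemma subsingleton_of_algHom_end
    (hnofd : ∀ (M : Type) [AddCommGroup M] [Module F M] [Module B M]
      [IsScalarTower F B M], FiniteDimensional F M → Subsingleton M)
    (M : Type) [AddCommGroup M] [Module F M] [FiniteDimensional F M]
    (g : B →ₐ[F] Module.End F M) : Subsingleton M := by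
  let _ : Module B M := Module.compHom M g.toRingHom
  have : IsScalarTower F B M := ⟨fun c b m => by
    change g (c • b) m = c • g b m
    rw [map_smul, LinearMap.smul_apply]⟩
  exact hnofd M inferInstance

/-- A surjection onto an algebra without finite-dimensional modules forces a finite-dimensional
representation to have no nonzero vector annihilated by its kernel. -/
lemma eq_zero_of_forall_ker_apply_eq_zero
    (hnofd : ∀ (M : Type) [AddCommGroup M] [Module F M] [Module B M]
      [IsScalarTower F B M], FiniteDimensional F M → Subsingleton M)
    (f : R →ₐ[F] B) (hf : Function.Surjective f)
    {M : Type} [AddCommGroup M] [Module F M] [FiniteDimensional F M]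
    (ρ : R →ₐ[F] Module.End F M) {u : M} (hu : ∀ x, f x = 0 → ρ x u = 0) : u = 0 := by
  let N : Submodule F M := ⨅ x : RingHom.ker f, ker (ρ x)
  have hN {v : M} : v ∈ N ↔ ∀ x, f x = 0 → ρ x v = 0 := by
    simp [N]
  have hmaps (y : R) : ∀ v ∈ N, ρ y v ∈ N := fun v hv => hN.2 fun x hx => by
    rw [← Module.End.mul_apply, ← map_mul]
    exact hN.1 hv _ (by rw [map_mul, hx, zero_mul])
  let ρN : R →ₐ[F] Module.End F N := AlgHom.ofLinearMap
    { toFun := fun y => (ρ y).restrict (hmaps y)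
      map_add' := fun y z => by ext v; simp
      map_smul' := fun c y => by ext v; simp }
    (by ext v; simp) (fun y z => by ext v; simp)
  obtain ⟨g, -⟩ := AlgHom.exists_comp_eq_of_surjective f hf ρN fun x hx => by
    ext v
    exact hN.1 v.2 x hx
  have := subsingleton_of_algHom_end hnofd N g
  exact congrArg Subtype.val (Subsingleton.elim (⟨u, hN.2 hu⟩ : N) 0)

end Descent

section Amenable

variable {F B : Type} [Field F] [Ring B] [Algebra F B]

/-- Compressing multiplication operators to a Følner subspace yields an almost representation. -/
lemma IsAmenableAlgebra.exists_compression {σ : Type} [Finite σ] (h : IsAmenableAlgebra F B)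
    (f : FreeAlgebra F σ →ₐ[F] B) {τ : Type} [Finite τ] (K : τ → FreeAlgebra F σ)
    (hK : ∀ t, f (K t) = 0) (κ : ℝ) (hκ : 0 < κ) :
    ∃ n : ℕ, 0 < n ∧ ∃ A : σ → Matrix (Fin n) (Fin n) F,
      ∀ t, ((evalPoly (K t) A).rank : ℝ) < κ * n := by
  obtain ⟨k, g, hg, hV⟩ := h
  have hsurj : Function.Surjective (FreeAlgebra.lift F g) := by
    rw [← AlgHom.range_eq_top, ← hg, Algebra.adjoin_range_eq_range_freeAlgebra_lift]
  choose Y hY using fun s => hsurj (f (FreeAlgebra.ι F s))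
  let ψ := FreeAlgebra.lift F Y
  have hψ (x : FreeAlgebra F σ) : FreeAlgebra.lift F g (ψ x) = f x := by
    have : (FreeAlgebra.lift F g).comp ψ = f := by
      ext s
      simp [ψ, hY]
    exact DFunLike.congr_fun this x
  choose C hC using fun t => exists_natRank_intertwiner_le (ψ (K t))
  obtain ⟨M, hM⟩ := (Set.finite_range C).bddAbove
  replace hM (t : τ) : C t ≤ M := hM ⟨t, rfl⟩
  obtain ⟨V, _, _, hVlt⟩ := hV (κ / (M * k + 1)) (by positivity)
  set W := Submodule.span F ({1} ∪ Set.range g) * V + V with hW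
  have hVW : V ≤ W := le_sup_right
  have hgW (l : Fin k) (v : B) (hv : v ∈ V) : g l * v ∈ W :=
    (le_sup_left : _ ≤ W) (Submodule.mul_mem_mul (Submodule.subset_span (by simp)) hv)
  set n := Module.finrank F V with hn
  let e : V ≃ₗ[F] (Fin n → F) := (Module.finBasis F V).equivFun
  let i : (Fin n → F) →ₗ[F] B := V.subtype ∘ₗ e.symm.toLinearMap
  have hi (x) : i x ∈ V := (e.symm x).2
  have hinj : ker i = ⊥ := ker_eq_bot.2 (V.injective_subtype.comp e.symm.injective)
  obtain ⟨p, hp⟩ := i.exists_leftInverse_of_injective hinj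
  replace hp (x) : p (i x) = x := DFunLike.congr_fun hp x
  let L (l : Fin k) : Module.End F B := Algebra.lmul F B (g l)
  let T (l : Fin k) : Module.End F (Fin n → F) := p ∘ₗ L l ∘ₗ i
  have hL (x : FreeAlgebra F (Fin k)) :
      FreeAlgebra.lift F L x = Algebra.lmul F B (FreeAlgebra.lift F g x) := by
    have : FreeAlgebra.lift F L = (Algebra.lmul F B).comp (FreeAlgebra.lift F g) := by
      ext l : 2
      simp [L]
    exact DFunLike.congr_fun this x
  have hdefect (l : Fin k) : natRank (i ∘ₗ T l - L l ∘ₗ i) + n ≤ Module.finrank F W := by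
    let D : W →ₗ[F] B := (i ∘ₗ p - LinearMap.id) ∘ₗ W.subtype
    have h1 : natRank (i ∘ₗ T l - L l ∘ₗ i) ≤ natRank D := by
      refine Submodule.finrank_mono ?_
      rintro _ ⟨x, rfl⟩
      exact ⟨⟨g l * i x, hgW l _ (hi x)⟩, by simp [D, T, L]⟩
    have h2 : n ≤ Module.finrank F (ker D) := by
      let j : V →ₗ[F] ker D := (Submodule.inclusion hVW).codRestrict (ker D) fun v => by
        have : i (e v) = v := by simp [i]
        simp [D, ← this, hp]
      refine LinearMap.finrank_le_finrank_of_injective (f := j) fun v w hvw => ?_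
      have := congrArg (fun z : ker D => ((z : W) : B)) hvw
      exact Subtype.ext this
    have h3 := finrank_range_add_finrank_ker D
    change natRank D + _ = _ at h3
    omega
  have hn0 : 0 < n := by
    by_contra h0
    have h0' : n = 0 := by omega
    rw [h0', Nat.cast_zero, mul_zero] at hVlt
    exact absurd hVlt (not_lt.2 (Nat.cast_nonneg _))
  refine ⟨n, hn0, fun s => toMatrix' (FreeAlgebra.lift F T (Y s)), fun t => ?_⟩
  have hrank : (evalPoly (K t) fun s => toMatrix' (FreeAlgebra.lift F T (Y s))).rank ≤
      M * (k * (Module.finrank F W - n)) := by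
    have hcomp : FreeAlgebra.lift F (fun s => FreeAlgebra.lift F T (Y s)) (K t) =
        FreeAlgebra.lift F T (ψ (K t)) := by
      have : FreeAlgebra.lift F (fun s => FreeAlgebra.lift F T (Y s)) =
          (FreeAlgebra.lift F T).comp ψ := by
        ext s : 2
        simp [ψ]
      exact DFunLike.congr_fun this _
    rw [← natRank_toLin', toLin'_evalPoly]
    simp only [Matrix.toLin'_toMatrix']
    rw [hcomp]
    have hker : natRank (FreeAlgebra.lift F T (ψ (K t))) =
        natRank (i ∘ₗ FreeAlgebra.lift F T (ψ (K t)) - FreeAlgebra.lift F L (ψ (K t)) ∘ₗ i) := by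
      refine natRank_eq_of_ker_eq ?_
      rw [hL, hψ, hK, map_zero, zero_comp, sub_zero, ker_comp_of_ker_eq_bot _ hinj]
    rw [hker]
    refine (hC t i T L).trans (Nat.mul_le_mul (hM t) ?_)
    refine (Finset.sum_le_card_nsmul _ _ (Module.finrank F W - n) fun l _ => ?_).trans (by simp)
    have := hdefect l
    omega
  have hnW : n ≤ Module.finrank F W := Submodule.finrank_mono hVW
  have hrank' : ((evalPoly (K t) fun s => toMatrix' (FreeAlgebra.lift F T (Y s))).rank : ℝ) ≤
      M * (k * (Module.finrank F W - n)) := by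
    rw [← Nat.cast_sub hnW]
    exact_mod_cast hrank
  refine hrank'.trans_lt ?_
  have hnpos : (0 : ℝ) < n := by exact_mod_cast hn0
  have hc : (0 : ℝ) < M * k + 1 := by positivity
  have hlt : (Module.finrank F W : ℝ) - n < κ / (M * k + 1) * n := by linarith
  have hMk : (0 : ℝ) ≤ M * k := by positivity
  calc (M : ℝ) * (k * (Module.finrank F W - n)) = M * k * (Module.finrank F W - n) := by ring
    _ ≤ M * k * (κ / (M * k + 1) * n) := by gcongr
    _ < (M * k + 1) * (κ / (M * k + 1) * n) := by
      gcongr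
      linarith
    _ = κ * n := by field_simp

end Amenable

section Bounds

variable {F : Type} [Field F]

lemma rank_le_padRankDiff_add {n n' : ℕ} (A : Matrix (Fin n) (Fin n) F)
    (B : Matrix (Fin n') (Fin n') F) :
    A.rank ≤ padRankDiff A B + (truncatedId F n' n).rank := by
  set D := truncatedId F n n' * (B * truncatedId F n' n) with hD
  have h1 : D.rank ≤ (truncatedId F n' n).rank :=
    (Matrix.rank_mul_le_right _ _).trans (Matrix.rank_mul_le_right _ _)
  have h2 : (A - D).rank ≤ padRankDiff A B := rank_sub_compression_le_padRankDiff A B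
  have h3 := natRank_add_le (A - D).toLin' D.toLin'
  rw [← map_add, sub_add_cancel] at h3
  simp only [natRank_toLin'] at h3
  omega

/-- If `R` has a nonzero constant term, a tuple on which `R` has small rank cannot consist of
matrices of small rank. -/
lemma le_rank_evalPoly_add {σ : Type} [Fintype σ] {R : FreeAlgebra F σ}
    (hR : FreeAlgebra.algebraMapInv R ≠ 0) {n : ℕ} (T : σ → Matrix (Fin n) (Fin n) F) {C : ℕ}
    (hC : natRank (LinearMap.id ∘ₗ FreeAlgebra.lift F (fun j => (T j).toLin') R -
        FreeAlgebra.lift F (fun _ => 0) R ∘ₗ LinearMap.id) ≤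
      C * ∑ j, natRank (LinearMap.id ∘ₗ (T j).toLin' - (0 : Module.End F (Fin n → F)) ∘ₗ
        LinearMap.id)) :
    n ≤ (evalPoly R T).rank + C * ∑ j, (T j).rank := by
  set a : Module.End F (Fin n → F) := algebraMap F _ (FreeAlgebra.algebraMapInv R) with ha
  have hconst : FreeAlgebra.lift F (fun _ : σ => (0 : Module.End F (Fin n → F))) R = a := by
    have : FreeAlgebra.lift F (fun _ : σ => (0 : Module.End F (Fin n → F))) =
        (Algebra.ofId F _).comp FreeAlgebra.algebraMapInv := by
      ext s : 2
      simp [FreeAlgebra.algebraMapInv]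
    exact DFunLike.congr_fun this R
  have hfull : natRank a = n := by
    have hker : ker a = ker (LinearMap.id : Module.End F (Fin n → F)) := by
      ext x
      simp [ha, hR]
    rw [natRank_eq_of_ker_eq hker, natRank, range_id, finrank_top, Module.finrank_fin_fun]
  simp only [LinearMap.id_comp, LinearMap.comp_id, sub_zero, natRank_toLin'] at hC
  rw [← toLin'_evalPoly, hconst] at hC
  have h := natRank_sub_le (evalPoly R T).toLin'
    ((evalPoly R T).toLin' - a)
  rw [sub_sub_cancel, hfull, natRank_toLin'] at h
  omega

/-- If `A / I` has no finite-dimensional modules and `I` is generated as a left ideal by the images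
of the `Q k`, then in any solution the `Q k` have trivial common kernel. This bounds the size of
the solution. -/
lemma rank_truncatedId_le {σ ι κ : Type} [Fintype σ] [Fintype κ] (P : ι → FreeAlgebra F σ)
    {A : Type} [Ring A] [Algebra F A] (π : FreeAlgebra F σ →ₐ[F] A)
    (hπ : Function.Surjective π)
    (hker : ∀ x, π x = 0 ↔ x ∈ TwoSidedIdeal.span (Set.range P))
    {I : Ideal A} {gen : κ → A} (hgen : Submodule.span A (Set.range gen) = I)
    {Q : κ → FreeAlgebra F σ} (hQ : ∀ k, π (Q k) = gen k)
    {B : Type} [Ring B] [Algebra F B] (f : FreeAlgebra F σ →ₐ[F] B)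
    (hf : Function.Surjective f) (hfI : ∀ x, f x = 0 → π x ∈ I)
    (hnofd : ∀ (M : Type) [AddCommGroup M] [Module F M] [Module B M]
      [IsScalarTower F B M], FiniteDimensional F M → Subsingleton M)
    {n n' : ℕ} {T : σ → Matrix (Fin n) (Fin n) F} {S : σ → Matrix (Fin n') (Fin n') F}
    (hS : ∀ i, evalPoly (P i) S = 0) {C : ℕ}
    (hC : ∀ k, natRank ((truncatedId F n' n).toLin' ∘ₗ
          FreeAlgebra.lift F (fun j => (T j).toLin') (Q k) -
        FreeAlgebra.lift F (fun j => (S j).toLin') (Q k) ∘ₗ (truncatedId F n' n).toLin') ≤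
      C * ∑ j, natRank ((truncatedId F n' n).toLin' ∘ₗ (T j).toLin' -
        (S j).toLin' ∘ₗ (truncatedId F n' n).toLin')) :
    (truncatedId F n' n).rank ≤
      ∑ k, ((evalPoly (Q k) T).rank + C * ∑ j, padRankDiff (T j) (S j)) := by
  set i := (truncatedId F n' n).toLin' with hi
  let ρ := FreeAlgebra.lift F (fun j => (S j).toLin')
  have hρ (x) (hx : π x = 0) : ρ x = 0 := by
    have hle : TwoSidedIdeal.span (Set.range P) ≤ TwoSidedIdeal.ker ρ := by
      rw [TwoSidedIdeal.span_le]
      rintro _ ⟨j, rfl⟩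
      change P j ∈ TwoSidedIdeal.ker ρ
      rw [TwoSidedIdeal.mem_ker, ← toLin'_evalPoly, hS, map_zero]
    exact (TwoSidedIdeal.mem_ker ρ).1 (hle ((hker x).1 hx))
  have hzero (u : Fin n' → F) (hu : ∀ k, ρ (Q k) u = 0) : u = 0 := by
    refine eq_zero_of_forall_ker_apply_eq_zero hnofd f hf ρ fun x hx => ?_
    have hx' := hfI x hx
    rw [← hgen] at hx'
    suffices h : ∀ a ∈ Submodule.span A (Set.range gen), ∀ y, π y = a → ρ y u = 0 from
      h _ hx' x rfl
    intro a ha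
    induction ha using Submodule.span_induction with
    | mem a ha =>
      obtain ⟨k, rfl⟩ := ha
      intro y hy
      have := hρ (y - Q k) (by rw [map_sub, hy, hQ, sub_self])
      rw [map_sub, sub_eq_zero] at this
      rw [this, hu]
    | zero =>
      intro y hy
      rw [hρ y hy, LinearMap.zero_apply]
    | add a b _ _ ha hb =>
      intro y hy
      obtain ⟨z, hz⟩ := hπ a
      have h1 := ha z hz
      have h2 := hb (y - z) (by rw [map_sub, hy, hz, add_sub_cancel_left])
      rwa [map_sub, LinearMap.sub_apply, h1, sub_zero] at h2
    | smul c a _ ha =>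
      intro y hy
      obtain ⟨z, hz⟩ := hπ a
      obtain ⟨w, hw⟩ := hπ c
      have := hρ (y - w * z) (by rw [map_sub, map_mul, hy, hz, hw, smul_eq_mul, sub_self])
      rw [map_sub, sub_eq_zero] at this
      rw [this, map_mul, Module.End.mul_apply, ha z hz, map_zero]
  rw [← natRank_toLin']
  refine (natRank_le_sum_natRank_comp i (fun k => ρ (Q k)) hzero).trans
    (Finset.sum_le_sum fun k _ => ?_)
  have hdefect : ∑ j, natRank (i ∘ₗ (T j).toLin' - (S j).toLin' ∘ₗ i) ≤
      ∑ j, padRankDiff (T j) (S j) := by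
    refine Finset.sum_le_sum fun j _ => ?_
    rw [hi, ← Matrix.toLin'_mul, ← Matrix.toLin'_mul, ← map_sub, natRank_toLin']
    exact rank_intertwiner_le_padRankDiff _ _
  have h1 := (hC k).trans (Nat.mul_le_mul_left C hdefect)
  rw [← toLin'_evalPoly] at h1
  have h2 := natRank_sub_le (i ∘ₗ (evalPoly (Q k) T).toLin')
    (i ∘ₗ (evalPoly (Q k) T).toLin' - ρ (Q k) ∘ₗ i)
  rw [sub_sub_cancel] at h2
  have h3 := natRank_comp_le_right i (evalPoly (Q k) T).toLin'
  rw [natRank_toLin'] at h3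
  exact h2.trans (add_le_add h3 h1)

end Bounds

/-- **Instability criterion.** Let `A = F⟨x_1,…,x_d⟩/⟨P_1,…,P_r⟩` be a finitely presented
algebra, and let `I ⊲ A` be a two-sided ideal which is finitely generated as a left ideal,
such that the quotient `B = A/I` is amenable and has no nonzero finite-dimensional (left)
module. Then the presentation is not rank-stable. -/
theorem stmt6_instability_criterion
    (F : Type) [Field F] (d r : ℕ)
    (P : Fin r → FreeAlgebra F (Fin d))
    (A : Type) [Ring A] [Algebra F A]
    (π : FreeAlgebra F (Fin d) →ₐ[F] A)
    (hπ : Function.Surjective π)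
    (hker : ∀ x, π x = 0 ↔ x ∈ TwoSidedIdeal.span (Set.range P))
    (I : Ideal A)                                  -- a left ideal of `A` …
    (hright : ∀ x ∈ I, ∀ a : A, x * a ∈ I)         -- … which is two-sided
    (hFG : I.FG)                                   -- finitely generated as a left ideal
    (B : Type) [Ring B] [Algebra F B]              -- the quotient algebra `A/I`:
    (q : A →ₐ[F] B)
    (hq : Function.Surjective q)
    (hqker : ∀ x : A, q x = 0 ↔ x ∈ I)
    (hamen : IsAmenableAlgebra F B)
    (hnofd : ∀ (M : Type) [AddCommGroup M] [Module F M] [Module B M]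
      [IsScalarTower F B M], FiniteDimensional F M → Subsingleton M) :
    ¬ RankStable F P := by
  intro hstable
  let f : FreeAlgebra F (Fin d) →ₐ[F] B := q.comp π
  have hf : Function.Surjective f := hq.comp hπ
  obtain ⟨m, gen, hgen⟩ := Submodule.fg_iff_exists_fin_generating_family.1 hFG
  choose Q hQ using fun k => hπ (gen k)
  have hQf (k : Fin m) : f (Q k) = 0 := by
    change q (π (Q k)) = 0
    rw [hqker, hQ, ← hgen]
    exact Submodule.subset_span ⟨k, rfl⟩
  have hPf (i : Fin r) : f (P i) = 0 := by
    have : π (P i) = 0 := (hker _).2 (TwoSidedIdeal.subset_span ⟨i, rfl⟩)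
    change q (π (P i)) = 0
    rw [this, map_zero]
  obtain ⟨R, hRf, hR⟩ : ∃ R, f R = 0 ∧ FreeAlgebra.algebraMapInv R ≠ 0 := by
    by_contra! h
    obtain ⟨g, -⟩ := AlgHom.exists_comp_eq_of_surjective f hf FreeAlgebra.algebraMapInv h
    have := subsingleton_of_algHom_end hnofd F ((Algebra.lmul F F).comp g)
    exact one_ne_zero (Subsingleton.elim (1 : F) 0)
  choose C hC using fun k => exists_natRank_intertwiner_le (Q k)
  obtain ⟨M, hM⟩ := (Set.finite_range C).bddAbove
  replace hM (k : Fin m) : C k ≤ M := hM ⟨k, rfl⟩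
  obtain ⟨C₀, hC₀⟩ := exists_natRank_intertwiner_le R
  set c : ℝ := 1 + C₀ * (d * (1 + m * (1 + M * d))) with hc
  have hc0 : 0 < c := by positivity
  set ε : ℝ := 1 / (2 * c) with hε
  have hε0 : 0 < ε := by positivity
  obtain ⟨δ, hδ, hstable⟩ := hstable ε hε0
  obtain ⟨n, hn, T, hT⟩ := hamen.exists_compression f
    (Sum.elim P (Sum.elim Q fun _ : Unit => R))
    (by rintro (i | k | -) <;> simp [hPf, hQf, hRf]) (min δ ε) (lt_min hδ hε0)
  have hnpos : (0 : ℝ) < n := by exact_mod_cast hn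
  have hTP (i) : ((evalPoly (P i) T).rank : ℝ) < δ * n :=
    (hT (Sum.inl i)).trans_le (by gcongr; exact min_le_left _ _)
  have hTQ (k) : ((evalPoly (Q k) T).rank : ℝ) ≤ ε * n :=
    (hT (Sum.inr (Sum.inl k))).le.trans (by gcongr; exact min_le_right _ _)
  have hTR : ((evalPoly R T).rank : ℝ) ≤ ε * n :=
    (hT (Sum.inr (Sum.inr ()))).le.trans (by gcongr; exact min_le_right _ _)
  obtain ⟨n', -, S, hSP, hTS⟩ := hstable n hn T hTP
  have hsum : ∑ j, (padRankDiff (T j) (S j) : ℝ) ≤ d * (ε * n) := by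
    refine (Finset.sum_le_card_nsmul _ _ (ε * n) fun j _ => (hTS j).le).trans ?_
    simp
  have hi : (truncatedId F n' n).rank ≤
      ∑ k, ((evalPoly (Q k) T).rank + M * ∑ j, padRankDiff (T j) (S j)) :=
    rank_truncatedId_le P π hπ hker hgen hQ f hf (fun x => (hqker (π x)).1) hnofd hSP
      fun k => (hC k _ _ _).trans (Nat.mul_le_mul_right _ (hM k))
  have hn_le : n ≤ (evalPoly R T).rank +
      C₀ * ∑ j, (padRankDiff (T j) (S j) + (truncatedId F n' n).rank) := by
    refine (le_rank_evalPoly_add hR T (hC₀ _ _ _)).trans ?_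
    gcongr with j
    exact rank_le_padRankDiff_add (T j) (S j)
  have hiR : ((truncatedId F n' n).rank : ℝ) ≤ m * (ε * n + M * (d * (ε * n))) := by
    have h1 : ((truncatedId F n' n).rank : ℝ) ≤
        ∑ k, ((evalPoly (Q k) T).rank + M * ∑ j, (padRankDiff (T j) (S j) : ℝ)) := by
      exact_mod_cast hi
    refine h1.trans ((Finset.sum_le_card_nsmul _ _ (ε * n + M * (d * (ε * n)))
      fun k _ => ?_).trans (by simp [mul_add]))
    have := hTQ k
    gcongr
  have hfinal : (n : ℝ) ≤ c * (ε * n) := by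
    have h1 : (n : ℝ) ≤ (evalPoly R T).rank +
        C₀ * ∑ j, ((padRankDiff (T j) (S j) : ℝ) + (truncatedId F n' n).rank) := by
      exact_mod_cast hn_le
    rw [Finset.sum_add_distrib, Finset.sum_const, Finset.card_univ, Fintype.card_fin,
      nsmul_eq_mul] at h1
    calc (n : ℝ) ≤ _ := h1
      _ ≤ ε * n + C₀ * (d * (ε * n) + d * (m * (ε * n + M * (d * (ε * n))))) := by gcongr
      _ = c * (ε * n) := by rw [hc]; ring
  have : c * (ε * n) = n / 2 := by rw [hε]; field_simp
  linarith
end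
end
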